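/- Let q ∈ QC with q|_{M_1^0(QC)} = 0 and q|_{M_{−1}^0(QC)} = 0. Then qχ_+ ∈ QC and qχ_− ∈ QC, where χ_+ and χ_− are the characteristic functions of the upper and lower semicircles respectively. -/

import Mathlib

open MeasureTheory Real Filter Topology

noncomputable section

/-- The `n`-th Fourier coefficient of `f : ℝ → ℂ` (representing `x ↦ f(e^{ix})`). -/
def fourierCoef (f : ℝ → ℂ) (n : ℤ) : ℂ :=
  (1 / (2 * π)) * ∫ x in (0 : ℝ)..(2 * π), f x * Complex.exp (-(Complex.I * n * x))

/-- `L^∞(T)`, modeled as bounded measurable `2π`-periodic functions `ℝ → ℂ`. -/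
def LinfT : Set (ℝ → ℂ) :=
  {f | Function.Periodic f (2 * π) ∧ Measurable f ∧ ∃ C, ∀ x, ‖f x‖ ≤ C}

/-- `C(T)`: continuous `2π`-periodic functions. -/
def CtsT : Set (ℝ → ℂ) := {f | Function.Periodic f (2 * π) ∧ Continuous f}

/-- The Hardy space `H^∞`: bounded functions whose negative Fourier coefficients vanish. -/
def HinfT : Set (ℝ → ℂ) := {f ∈ LinfT | ∀ n : ℤ, n < 0 → fourierCoef f n = 0}

/-- The conjugate Hardy space: bounded functions whose positive Fourier coefficients vanish. -/
def HinfBarT : Set (ℝ → ℂ) := {f ∈ LinfT | ∀ n : ℤ, 0 < n → fourierCoef f n = 0}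

/-- The quasicontinuous functions `QC = (C + H^∞) ∩ (C + conj(H^∞))`. -/
def QCset : Set (ℝ → ℂ) :=
  {f | (∃ c ∈ CtsT, ∃ h ∈ HinfT, f = c + h) ∧ (∃ c ∈ CtsT, ∃ h ∈ HinfBarT, f = c + h)}

/-- The flip `q̃(t) = q(1/t)`, i.e. `q̃(e^{ix}) = q(e^{-ix})`. -/
def flipF (f : ℝ → ℂ) : ℝ → ℂ := fun x => f (-x)

/-- The even quasicontinuous functions `Q̃C = {q ∈ QC : q = q̃}`. -/
def tQCset : Set (ℝ → ℂ) := {f ∈ QCset | flipF f = f}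

/-- The even continuous functions `C̃(T)`. -/
def evContT : Set (ℝ → ℂ) := {f ∈ CtsT | flipF f = f}

/-- The piecewise continuous functions `PC`: `2π`-periodic functions having one-sided
limits at every point. -/
def PCset : Set (ℝ → ℂ) :=
  {p | Function.Periodic p (2 * π) ∧
    ∀ θ : ℝ, (∃ l : ℂ, Tendsto p (𝓝[>] θ) (𝓝 l)) ∧ (∃ l : ℂ, Tendsto p (𝓝[<] θ) (𝓝 l))}

/-- `ξ` is a character (multiplicative linear functional of norm `1`) of the subalgebra of
`L^∞(T)` whose underlying set is `S`; only the values of `ξ` on `S` are relevant. -/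
def IsChar (S : Set (ℝ → ℂ)) (ξ : (ℝ → ℂ) → ℂ) : Prop :=
  (∀ p ∈ S, ∀ q ∈ S, ξ (p + q) = ξ p + ξ q) ∧
  (∀ p ∈ S, ∀ q ∈ S, ξ (p * q) = ξ p * ξ q) ∧
  (∀ (c : ℂ), ∀ q ∈ S, ξ (c • q) = c * ξ q) ∧
  ξ 1 = 1 ∧
  (∀ q ∈ S, ∀ C : ℝ, (∀ x, ‖q x‖ ≤ C) → ‖ξ q‖ ≤ C)

/-- The moving average `δ_{λ,τ}(a) = (λ/2π) ∫_{θ-π/λ}^{θ+π/λ} a(e^{ix}) dx`, `τ = e^{iθ}`. -/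
def movAvg (a : ℝ → ℂ) (lam θ : ℝ) : ℂ :=
  (lam / (2 * π)) * ∫ x in (θ - π / lam)..(θ + π / lam), a x

/-- `ξ ∈ M_τ^0(S)` (`τ = e^{iθ}`): `ξ` is a character of (the algebra with underlying set) `S`
lying in the weak-* closure of the moving-average functionals `{δ_{λ,τ} : λ ∈ [1,∞)}`. -/
def InM0 (S : Set (ℝ → ℂ)) (θ : ℝ) (ξ : (ℝ → ℂ) → ℂ) : Prop :=
  IsChar S ξ ∧
  ∀ qs : List (ℝ → ℂ), (∀ q ∈ qs, q ∈ S) → ∀ ε : ℝ, 0 < ε →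
    ∃ lam : ℝ, 1 ≤ lam ∧ ∀ q ∈ qs, ‖ξ q - movAvg q lam θ‖ < ε

/-- `ξ ∈ M_τ(S)` (`τ = e^{iθ}`): the fiber condition `ξ(f) = f(τ)` for all continuous `f`
belonging to `S`. -/
def InFiber (S : Set (ℝ → ℂ)) (θ : ℝ) (ξ : (ℝ → ℂ) → ℂ) : Prop :=
  IsChar S ξ ∧ ∀ f ∈ CtsT ∩ S, ξ f = f θ

/-- `ξ ∈ M_τ^+(QC)`: `ξ(f) = 0` whenever `limsup_{t→τ+0}|f(t)| = 0`, `f ∈ QC`. -/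
def InMplus (θ : ℝ) (ξ : (ℝ → ℂ) → ℂ) : Prop :=
  IsChar QCset ξ ∧
  ∀ f ∈ QCset, Filter.limsup (fun x => ‖f x‖) (𝓝[>] θ) = 0 → ξ f = 0

/-- `ξ ∈ M_τ^-(QC)`: `ξ(f) = 0` whenever `limsup_{t→τ-0}|f(t)| = 0`, `f ∈ QC`. -/
def InMminus (θ : ℝ) (ξ : (ℝ → ℂ) → ℂ) : Prop :=
  IsChar QCset ξ ∧
  ∀ f ∈ QCset, Filter.limsup (fun x => ‖f x‖) (𝓝[<] θ) = 0 → ξ f = 0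

/-- The conjugate character `ξ'(q) = ξ(q̃)`. -/
def conjChar (ξ : (ℝ → ℂ) → ℂ) : (ℝ → ℂ) → ℂ := fun q => ξ (flipF q)

/-- The characteristic function `χ_+` of the upper semicircle `{e^{ix} : 0 < x < π}`. -/
def chiPlus : ℝ → ℂ := fun x => if 0 < Real.sin x then 1 else 0

/-- The characteristic function `χ_-` of the lower semicircle `{e^{ix} : -π < x < 0}`. -/
def chiMinus : ℝ → ℂ := fun x => if Real.sin x < 0 then 1 else 0

namespace QCP

open Complex (I)

instance twoPiFact : Fact (0 < 2 * π) := ⟨Real.two_pi_pos⟩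

lemma linf_add {f g : ℝ → ℂ} (hf : f ∈ LinfT) (hg : g ∈ LinfT) : f + g ∈ LinfT := by
  obtain ⟨a, b, C, hC⟩ := hf
  obtain ⟨a', b', C', hC'⟩ := hg
  refine ⟨a.add a', b.add b', C + C', fun x => ?_⟩
  exact (norm_add_le _ _).trans (add_le_add (hC x) (hC' x))

lemma linf_mul {f g : ℝ → ℂ} (hf : f ∈ LinfT) (hg : g ∈ LinfT) : f * g ∈ LinfT := by
  obtain ⟨a, b, C, hC⟩ := hf
  obtain ⟨a', b', C', hC'⟩ := hg
  refine ⟨a.mul a', b.mul b', C * C', fun x => ?_⟩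
  rw [Pi.mul_apply, norm_mul]
  exact mul_le_mul (hC x) (hC' x) (norm_nonneg _) ((norm_nonneg _).trans (hC x))

lemma linf_const (c : ℂ) : (fun _ => c) ∈ LinfT :=
  ⟨fun _ => rfl, measurable_const, ‖c‖, fun _ => le_rfl⟩

lemma linf_smul {f : ℝ → ℂ} (c : ℂ) (hf : f ∈ LinfT) : c • f ∈ LinfT :=
  linf_mul (linf_const c) hf

lemma linf_neg {f : ℝ → ℂ} (hf : f ∈ LinfT) : -f ∈ LinfT := by
  simpa using linf_smul (-1) hf

lemma linf_sub {f g : ℝ → ℂ} (hf : f ∈ LinfT) (hg : g ∈ LinfT) : f - g ∈ LinfT := by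
  simpa [sub_eq_add_neg] using linf_add hf (linf_neg hg)

/-- pointwise conjugation -/
def cj (f : ℝ → ℂ) : ℝ → ℂ := fun x => (starRingEnd ℂ) (f x)

/-- shift -/
def sh (θ : ℝ) (f : ℝ → ℂ) : ℝ → ℂ := fun x => f (x + θ)

lemma linf_cj {f : ℝ → ℂ} (hf : f ∈ LinfT) : cj f ∈ LinfT := by
  obtain ⟨a, b, C, hC⟩ := hf
  refine ⟨fun x => by simp [cj, a x], ?_, C, fun x => by simpa [cj] using hC x⟩
  exact Complex.continuous_conj.measurable.comp b

lemma linf_sh {f : ℝ → ℂ} (θ : ℝ) (hf : f ∈ LinfT) : sh θ f ∈ LinfT := by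
  obtain ⟨a, b, C, hC⟩ := hf
  refine ⟨fun x => ?_, ?_, C, fun x => hC _⟩
  · have := a (x + θ)
    simp only [sh]; rw [← this]; ring_nf
  · exact b.comp (measurable_id.add_const θ)

lemma periodic_bdd {f : ℝ → ℂ} (hf : Function.Periodic f (2 * π)) (hc : Continuous f) :
    ∃ C, ∀ x, ‖f x‖ ≤ C := by
  obtain ⟨C, hC⟩ := (isCompact_Icc (a := (0:ℝ)) (b := 2 * π)).exists_bound_of_continuousOn
    hc.continuousOn
  refine ⟨C, fun x => ?_⟩
  obtain ⟨y, hy, hxy⟩ := hf.exists_mem_Ico₀ Real.two_pi_pos x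
  rw [hxy]; exact hC y ⟨hy.1, hy.2.le⟩

lemma linf_of_cts {f : ℝ → ℂ} (hf : f ∈ CtsT) : f ∈ LinfT :=
  ⟨hf.1, hf.2.measurable, periodic_bdd hf.1 hf.2⟩

lemma linf_int {f : ℝ → ℂ} (hf : f ∈ LinfT) (a b : ℝ) : IntervalIntegrable f volume a b := by
  obtain ⟨_, hm, C, hC⟩ := hf
  rw [intervalIntegrable_iff]
  exact Measure.integrableOn_of_bounded (M := C) (by simp) hm.aestronglyMeasurable
    (Filter.Eventually.of_forall hC)

/-- mean value -/
def mn (f : ℝ → ℂ) : ℂ := (1 / (2 * π)) * ∫ x in (0 : ℝ)..(2 * π), f x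

lemma mn_add {f g : ℝ → ℂ} (hf : f ∈ LinfT) (hg : g ∈ LinfT) : mn (f + g) = mn f + mn g := by
  simp only [mn, Pi.add_apply]
  rw [intervalIntegral.integral_add (linf_int hf _ _) (linf_int hg _ _)]; ring

lemma mn_sub {f g : ℝ → ℂ} (hf : f ∈ LinfT) (hg : g ∈ LinfT) : mn (f - g) = mn f - mn g := by
  simp only [mn, Pi.sub_apply]
  rw [intervalIntegral.integral_sub (linf_int hf _ _) (linf_int hg _ _)]; ring

lemma mn_smul (c : ℂ) (f : ℝ → ℂ) : mn (c • f) = c * mn f := by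
  simp only [mn, Pi.smul_apply, smul_eq_mul]
  rw [intervalIntegral.integral_const_mul]; ring

lemma mn_cj (f : ℝ → ℂ) : mn (cj f) = (starRingEnd ℂ) (mn f) := by
  simp only [mn, cj, map_mul]
  rw [intervalIntegral.integral_of_le Real.two_pi_pos.le, intervalIntegral.integral_of_le Real.two_pi_pos.le]
  rw [integral_conj]
  have : (starRingEnd ℂ) 2 = 2 := Complex.conj_ofNat 2
  simp [this]

lemma mn_sh {f : ℝ → ℂ} (hf : Function.Periodic f (2 * π)) (θ : ℝ) : mn (sh θ f) = mn f := by
  simp only [mn, sh]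
  rw [intervalIntegral.integral_comp_add_right]
  congr 1
  have := hf.intervalIntegral_add_eq θ 0
  simpa [add_comm] using this

/-- exponentials -/
def ex (n : ℤ) : ℝ → ℂ := fun x => Complex.exp (I * n * x)

lemma ex_cts (n : ℤ) : ex n ∈ CtsT := by
  refine ⟨fun x => ?_, by unfold ex; fun_prop⟩
  simp only [ex]
  rw [Complex.exp_eq_exp_iff_exists_int]
  exact ⟨n, by push_cast; ring⟩

lemma ex_linf (n : ℤ) : ex n ∈ LinfT := linf_of_cts (ex_cts n)

lemma ex_mul (n m : ℤ) : ex n * ex m = ex (n + m) := by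
  ext x; simp only [ex, Pi.mul_apply, ← Complex.exp_add]; push_cast; ring_nf

lemma fc_eq (f : ℝ → ℂ) (n : ℤ) : fourierCoef f n = mn (f * ex (-n)) := by
  simp only [fourierCoef, mn, ex, Pi.mul_apply]
  push_cast
  simp only [mul_neg, neg_mul]

lemma cj_ex (n : ℤ) : cj (ex n) = ex (-n) := by
  ext x; simp only [cj, ex, ← Complex.exp_conj]; simp

lemma cj_mul (f g : ℝ → ℂ) : cj (f * g) = cj f * cj g := by ext x; simp [cj]
lemma cj_add (f g : ℝ → ℂ) : cj (f + g) = cj f + cj g := by ext x; simp [cj]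
lemma cj_cj (f : ℝ → ℂ) : cj (cj f) = f := by ext x; simp [cj]

lemma fc_cj (f : ℝ → ℂ) (n : ℤ) : fourierCoef (cj f) n = (starRingEnd ℂ) (fourierCoef f (-n)) := by
  rw [fc_eq, fc_eq, ← mn_cj, cj_mul, cj_ex, neg_neg]

lemma fc_sh {f : ℝ → ℂ} (hf : f ∈ LinfT) (θ : ℝ) (n : ℤ) :
    fourierCoef (sh θ f) n = Complex.exp (I * n * θ) * fourierCoef f n := by
  rw [fc_eq, fc_eq, ← mn_sh (linf_mul hf (ex_linf (-n))).1 θ, ← mn_smul]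
  congr 1
  ext x
  simp only [sh, ex, Pi.mul_apply, Pi.smul_apply, smul_eq_mul]
  rw [mul_left_comm, ← Complex.exp_add]
  push_cast; ring_nf

lemma fc_add {f g : ℝ → ℂ} (hf : f ∈ LinfT) (hg : g ∈ LinfT) (n : ℤ) :
    fourierCoef (f + g) n = fourierCoef f n + fourierCoef g n := by
  simp only [fc_eq, add_mul]
  exact mn_add (linf_mul hf (ex_linf _)) (linf_mul hg (ex_linf _))

lemma fc_sub {f g : ℝ → ℂ} (hf : f ∈ LinfT) (hg : g ∈ LinfT) (n : ℤ) :
    fourierCoef (f - g) n = fourierCoef f n - fourierCoef g n := by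
  simp only [fc_eq, sub_mul]
  exact mn_sub (linf_mul hf (ex_linf _)) (linf_mul hg (ex_linf _))

lemma fc_smul (c : ℂ) (f : ℝ → ℂ) (n : ℤ) :
    fourierCoef (c • f) n = c * fourierCoef f n := by
  simp only [fc_eq, smul_mul_assoc, mn_smul]

lemma fc_mul_ex (f : ℝ → ℂ) (m n : ℤ) : fourierCoef (f * ex m) n = fourierCoef f (n - m) := by
  simp only [fc_eq, mul_assoc, ex_mul]; congr 3; ring

/-- lift to the circle -/
def lf {f : ℝ → ℂ} (hf : f ∈ LinfT) : AddCircle (2 * π) → ℂ := hf.1.lift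

lemma lf_coe {f : ℝ → ℂ} (hf : f ∈ LinfT) (x : ℝ) : lf hf (x : AddCircle (2 * π)) = f x := rfl

lemma lf_meas {f : ℝ → ℂ} (hf : f ∈ LinfT) : Measurable (lf hf) := by
  have : lf hf = fun y => f ((AddCircle.measurableEquivIoc (2 * π) 0 y : ℝ)) := by
    ext y
    rw [← lf_coe hf]
    congr 1
    exact (AddCircle.coe_equivIoc (p := 2 * π) (a := 0)).symm
  rw [this]
  exact hf.2.1.comp (measurable_subtype_coe.comp (AddCircle.measurableEquivIoc (2 * π) 0).measurable)

lemma lf_memLp {f : ℝ → ℂ} (hf : f ∈ LinfT) : MemLp (lf hf) 2 (AddCircle.haarAddCircle (T := 2 * π)) := by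
  obtain ⟨C, hC⟩ := hf.2.2
  refine MemLp.of_bound (lf_meas hf).aestronglyMeasurable C (Filter.Eventually.of_forall fun y => ?_)
  induction y using QuotientAddGroup.induction_on with
  | H x => exact hC x

lemma lf_fc {f : ℝ → ℂ} (hf : f ∈ LinfT) (n : ℤ) : fourierCoeff (lf hf) n = fourierCoef f n := by
  rw [fourierCoeff_eq_intervalIntegral _ _ 0]
  simp only [fourierCoef, zero_add, lf_coe]
  rw [Complex.real_smul]
  push_cast
  congr 1
  apply intervalIntegral.integral_congr
  intro x _
  simp only [fourier_coe_apply, smul_eq_mul]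
  rw [mul_comm]
  congr 2
  have : (π : ℂ) ≠ 0 := by exact_mod_cast Real.pi_ne_zero
  push_cast
  field_simp

lemma lf_mean {f : ℝ → ℂ} (hf : f ∈ LinfT) :
    ∫ y, lf hf y ∂(AddCircle.haarAddCircle (T := 2 * π)) = mn f := by
  have := lf_fc hf 0
  have h0 : ex 0 = 1 := by ext x; simp [ex]
  simpa [fourierCoeff, fc_eq, h0] using this

/-- Parseval -/
lemma parseval {f g : ℝ → ℂ} (hf : f ∈ LinfT) (hg : g ∈ LinfT) :
    HasSum (fun n : ℤ => fourierCoef f n * fourierCoef g (-n)) (mn (f * g)) := by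
  set X := (lf_memLp (linf_cj hg)).toLp with hX
  set Y := (lf_memLp hf).toLp with hY
  have h := (fourierBasis (T := 2 * π)).hasSum_inner_mul_inner X Y
  have e1 : ∀ n, inner ℂ ((fourierBasis (T := 2 * π)) n) Y = fourierCoef f n := by
    intro n
    rw [← HilbertBasis.repr_apply_apply, fourierBasis_repr, ← lf_fc hf]
    exact congrFun (fourierCoeff_congr_ae (MemLp.coeFn_toLp _)) n
  have e2 : ∀ n, inner ℂ X ((fourierBasis (T := 2 * π)) n) = fourierCoef g (-n) := by
    intro n
    rw [← inner_conj_symm, ← HilbertBasis.repr_apply_apply, fourierBasis_repr]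
    rw [show fourierCoeff X n = fourierCoef (cj g) n from ?_, fc_cj, Complex.conj_conj]
    rw [← lf_fc (linf_cj hg)]
    exact congrFun (fourierCoeff_congr_ae (MemLp.coeFn_toLp _)) n
  have e3 : inner ℂ X Y = mn (f * g) := by
    rw [← lf_mean (linf_mul hf hg), MeasureTheory.L2.inner_def]
    apply integral_congr_ae
    filter_upwards [MemLp.coeFn_toLp (lf_memLp (linf_cj hg)), MemLp.coeFn_toLp (lf_memLp hf)] with y h1 h2
    rw [h1, h2]
    induction y using QuotientAddGroup.induction_on with
    | H x => 
      change inner ℂ (cj g x) (f x) = f x * g x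
      simp [cj]
  rw [e3] at h
  simp only [e1, e2] at h
  simpa only [mul_comm] using h

end QCP

namespace QCP

open Complex (I)

lemma cauchy {g : ℂ → ℂ} (hg : DifferentiableOn ℂ g (Metric.closedBall 0 1)) {t : ℝ} (ht : |t| < 1) :
    mn (fun x => g (Complex.exp (I * x)) * Complex.exp (I * x) / (Complex.exp (I * x) - t)) = g t := by
  have htb : (t : ℂ) ∈ Metric.ball (0 : ℂ) 1 := by simpa using ht
  have h := DiffContOnCl.circleIntegral_sub_inv_smul (c := 0) (R := 1) (w := (t : ℂ)) (f := g)
    (hg.mono Metric.closure_ball_subset_closedBall).diffContOnCl htb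
  rw [circleIntegral] at h
  simp only [deriv_circleMap, circleMap, smul_eq_mul] at h
  have h2 : ∫ x in (0:ℝ)..(2 * π), g (Complex.exp (I * x)) * Complex.exp (I * x) / (Complex.exp (I * x) - t)
      = I⁻¹ * (2 * π * I * g t) := by
    rw [← h, ← intervalIntegral.integral_const_mul]
    apply intervalIntegral.integral_congr
    intro x _
    have := Complex.I_ne_zero
    simp only [zero_add, Complex.ofReal_one, one_mul, mul_comm (x : ℂ) I]
    field_simp
  rw [mn, h2]
  have := Complex.I_ne_zero
  have : (π : ℂ) ≠ 0 := by exact_mod_cast Real.pi_ne_zero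
  field_simp

/-- Poisson kernel -/
def pk (t x : ℝ) : ℝ := (1 - t ^ 2) / (1 - 2 * t * Real.cos x + t ^ 2)

def pkC (t : ℝ) : ℝ → ℂ := fun x => (pk t x : ℂ)

lemma pk_den_pos {t : ℝ} (ht : |t| < 1) (x : ℝ) : 0 < 1 - 2 * t * Real.cos x + t ^ 2 := by
  obtain ⟨h1, h2⟩ := abs_lt.1 ht
  have h3 := Real.cos_le_one x
  have h4 := Real.neg_one_le_cos x
  have h5 := Real.sin_sq_add_cos_sq x
  nlinarith [sq_nonneg (Real.sin x), sq_nonneg (t - Real.cos x), mul_pos (by linarith : 0 < 1 - t) (by linarith : 0 < 1 + t), sq_nonneg (1 - t * Real.cos x)]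

lemma pk_nonneg {t : ℝ} (ht : |t| < 1) (x : ℝ) : 0 ≤ pk t x := by
  have := (sq_lt_one_iff_abs_lt_one t).2 ht
  exact div_nonneg (by linarith) (pk_den_pos ht x).le

lemma pk_cont {t : ℝ} (ht : |t| < 1) : Continuous (pk t) := by
  unfold pk
  exact Continuous.div (by fun_prop) (by fun_prop) fun x => (pk_den_pos ht x).ne'

lemma pkC_cts {t : ℝ} (ht : |t| < 1) : pkC t ∈ CtsT := by
  refine ⟨fun x => by simp [pkC, pk], ?_⟩
  exact Complex.continuous_ofReal.comp (pk_cont ht)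

lemma pkC_linf {t : ℝ} (ht : |t| < 1) : pkC t ∈ LinfT := linf_of_cts (pkC_cts ht)

lemma cj_pkC (t : ℝ) : cj (pkC t) = pkC t := by ext x; simp [cj, pkC]

lemma one_sub_ne {t : ℝ} (ht : |t| < 1) {z : ℂ} (hz : ‖z‖ ≤ 1) : 1 - z * t ≠ 0 := by
  intro h
  have : z * t = 1 := (sub_eq_zero.1 h).symm
  have h2 : ‖z * t‖ = 1 := by rw [this]; simp
  rw [norm_mul, Complex.norm_real, Real.norm_eq_abs] at h2
  nlinarith [norm_nonneg z, abs_nonneg t]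

lemma norm_expI (x : ℝ) : ‖Complex.exp (I * x)‖ = 1 := by
  rw [mul_comm]; exact Complex.norm_exp_ofReal_mul_I x

lemma expI_sub_ne {t : ℝ} (ht : |t| < 1) (x : ℝ) : Complex.exp (I * x) - t ≠ 0 := by
  intro h
  have := congrArg norm (sub_eq_zero.1 h)
  rw [norm_expI, Complex.norm_real, Real.norm_eq_abs] at this
  linarith

lemma pkC_eq {t : ℝ} (ht : |t| < 1) (x : ℝ) : pkC t x =
    ((1 - t ^ 2 : ℂ) / (1 - Complex.exp (I * x) * t)) * Complex.exp (I * x) / (Complex.exp (I * x) - t) := by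
  have h1 := expI_sub_ne ht x
  have h2 := one_sub_ne ht (norm_expI x).le
  have h3 := (pk_den_pos ht x).ne'
  have hz := Complex.exp_ne_zero (I * x)
  have h4 : (2 * Real.cos x : ℂ) = Complex.exp (I * x) + (Complex.exp (I * x))⁻¹ := by
    rw [← Complex.exp_neg, Complex.ofReal_cos, Complex.two_cos]; ring_nf
  have h5 : ((1 - 2 * t * Real.cos x + t ^ 2 : ℝ) : ℂ) =
      (1 - Complex.exp (I * x) * t) * (Complex.exp (I * x) - t) / Complex.exp (I * x) := by
    push_cast
    rw [show (1 - 2 * t * Complex.cos x + t ^ 2 : ℂ) = 1 - t * (2 * Real.cos x) + t ^ 2 by push_cast; ring, h4]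
    field_simp
    ring
  have h6 : ((1 - 2 * t * Real.cos x + t ^ 2 : ℝ) : ℂ) ≠ 0 := by exact_mod_cast h3
  rw [pkC, pk, Complex.ofReal_div, h5]
  push_cast
  field_simp

lemma mn_ex_pk {t : ℝ} (ht : |t| < 1) (m : ℕ) : mn (ex m * pkC t) = (t : ℂ) ^ m := by
  have hg : DifferentiableOn ℂ (fun z : ℂ => z ^ m * ((1 - t ^ 2 : ℂ) / (1 - z * t))) (Metric.closedBall 0 1) := by
    intro z hz
    have hz' : ‖z‖ ≤ 1 := by simpa using hz
    have := one_sub_ne ht hz'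
    exact DifferentiableAt.differentiableWithinAt (by fun_prop (disch := assumption))
  have h := cauchy hg ht
  have h2 : (1 - t * t : ℂ) ≠ 0 := by
    have := one_sub_ne ht (z := t) (by simpa using ht.le)
    exact this
  rw [show (t : ℂ) ^ m * ((1 - t ^ 2 : ℂ) / (1 - t * t)) = (t:ℂ) ^ m by
    rw [sq, div_self h2, mul_one]] at h
  rw [← h]
  congr 1
  ext x
  rw [Pi.mul_apply, pkC_eq ht, ex, ← Complex.exp_nat_mul]
  push_cast
  ring_nf

lemma fc_pk {t : ℝ} (ht : |t| < 1) (n : ℤ) : fourierCoef (pkC t) n = (t : ℂ) ^ n.natAbs := by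
  have key : ∀ m : ℕ, fourierCoef (pkC t) (-m) = (t : ℂ) ^ m := by
    intro m
    rw [fc_eq, neg_neg, mul_comm, mn_ex_pk ht]
  obtain ⟨m, rfl | rfl⟩ := n.eq_nat_or_neg
  · rw [← cj_pkC, fc_cj, key]; simp
  · rw [key]; simp

/-- Poisson integral at `t` -/
def PP (f : ℝ → ℂ) (t : ℝ) : ℂ := mn (f * pkC t)

lemma PP_add {f g : ℝ → ℂ} (hf : f ∈ LinfT) (hg : g ∈ LinfT) {t : ℝ} (ht : |t| < 1) :
    PP (f + g) t = PP f t + PP g t := by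
  rw [PP, add_mul]; exact mn_add (linf_mul hf (pkC_linf ht)) (linf_mul hg (pkC_linf ht))

lemma PP_sub {f g : ℝ → ℂ} (hf : f ∈ LinfT) (hg : g ∈ LinfT) {t : ℝ} (ht : |t| < 1) :
    PP (f - g) t = PP f t - PP g t := by
  rw [PP, sub_mul]; exact mn_sub (linf_mul hf (pkC_linf ht)) (linf_mul hg (pkC_linf ht))

lemma PP_smul (c : ℂ) (f : ℝ → ℂ) (t : ℝ) : PP (c • f) t = c * PP f t := by
  rw [PP, smul_mul_assoc, mn_smul]; rfl

lemma PP_cj (f : ℝ → ℂ) (t : ℝ) : PP (cj f) t = (starRingEnd ℂ) (PP f t) := by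
  rw [PP, PP, ← mn_cj, cj_mul, cj_pkC]

lemma PP_sh_pi {f : ℝ → ℂ} (hf : f ∈ LinfT) {t : ℝ} (ht : |t| < 1) : PP (sh π f) t = PP f (-t) := by
  have ht' : |-t| < 1 := by simpa using ht
  rw [PP, PP, ← mn_sh (linf_mul hf (pkC_linf ht')).1 π]
  congr 1
  ext x
  simp [sh, pkC, pk]

lemma PP_hasSum {f : ℝ → ℂ} (hf : f ∈ LinfT) {t : ℝ} (ht : |t| < 1) :
    HasSum (fun n : ℤ => fourierCoef f n * (t : ℂ) ^ n.natAbs) (PP f t) := by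
  have := parseval hf (pkC_linf ht)
  simpa [fc_pk ht, PP] using this

lemma PP_ex {t : ℝ} (ht : |t| < 1) (n : ℤ) : PP (ex n) t = (t : ℂ) ^ n.natAbs := by
  rw [PP, mul_comm]
  have := fc_pk ht (-n)
  rw [fc_eq, neg_neg] at this
  simpa using this

lemma hs_congr {f g : ℤ → ℂ} {a : ℂ} (h : HasSum g a) (e : ∀ n, f n = g n) : HasSum f a := by
  rw [funext e]; exact h

lemma PP_mul {h k : ℝ → ℂ} (hh : h ∈ HinfT) (hk : k ∈ HinfT) {t : ℝ} (ht : |t| < 1) :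
    PP (h * k) t = PP h t * PP k t := by
  have key : ∀ n : ℕ, mn (h * (pkC t * ex n)) = PP h t * (t : ℂ) ^ n := by
    intro n
    have h1 := parseval hh.1 (linf_mul (pkC_linf ht) (ex_linf n))
    have h2 := (PP_hasSum hh.1 ht).mul_right ((t : ℂ) ^ n)
    refine h1.unique ?_
    refine hs_congr h2 fun m => ?_
    rw [fc_mul_ex, fc_pk ht]
    rcases lt_or_ge m 0 with hm | hm
    · rw [hh.2 m hm]; simp
    · rw [mul_assoc, ← pow_add]; congr 2; omega
  have h1 := parseval hk.1 (linf_mul hh.1 (pkC_linf ht))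
  have h2 := (PP_hasSum hk.1 ht).mul_left (PP h t)
  rw [PP, mul_comm h k, mul_assoc]
  refine h1.unique ?_
  refine hs_congr h2 fun n => ?_
  rcases lt_or_ge n 0 with hn | hn
  · rw [hk.2 n hn]; simp
  · obtain ⟨m, rfl⟩ := Int.eq_ofNat_of_zero_le hn
    rw [fc_eq (h * pkC t), neg_neg, mul_assoc h, key]
    simp; ring

lemma real_poisson {A B : ℝ} {t : ℝ} (ht : |t| < 1) :
    (1 / (2 * π)) * ∫ x in (0:ℝ)..(2 * π), (A + B * (1 - Real.cos x)) * pk t x = A + B * (1 - t) := by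
  have h : PP (((A + B : ℝ) : ℂ) • ex 0 - ((B / 2 : ℝ) : ℂ) • (ex 1 + ex (-1))) t = A + B * (1 - t) := by
    rw [PP_sub (linf_smul _ (ex_linf _)) (linf_smul _ (linf_add (ex_linf _) (ex_linf _))) ht,
      PP_smul, PP_smul, PP_add (ex_linf _) (ex_linf _) ht, PP_ex ht, PP_ex ht, PP_ex ht]
    simp
    ring
  have h2 : PP (((A + B : ℝ) : ℂ) • ex 0 - ((B / 2 : ℝ) : ℂ) • (ex 1 + ex (-1))) t =
      (((1 / (2 * π)) * ∫ x in (0:ℝ)..(2 * π), (A + B * (1 - Real.cos x)) * pk t x : ℝ) : ℂ) := by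
    rw [PP, mn, Complex.ofReal_mul, ← intervalIntegral.integral_ofReal]
    push_cast
    congr 1
    apply intervalIntegral.integral_congr
    intro x _
    have h4 : Complex.cos x = (Complex.exp (I * x) + Complex.exp (-(I * x))) / 2 := by
      rw [Complex.cos]; ring_nf
    simp only [ex, pkC, Pi.mul_apply, Pi.sub_apply, Pi.smul_apply, Pi.add_apply, smul_eq_mul]
    push_cast
    rw [h4]
    simp only [mul_zero, zero_mul, Complex.exp_zero, mul_one, mul_neg, neg_mul]
    ring
  rw [h2] at h
  exact_mod_cast h

lemma PP_bound {f : ℝ → ℂ} {A B t : ℝ} (ht : |t| < 1)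
    (hb : ∀ x, ‖f x‖ ≤ A + B * (1 - Real.cos x)) : ‖PP f t‖ ≤ A + B * (1 - t) := by
  rw [← real_poisson ht, PP, mn, norm_mul]
  have hpi := Real.pi_pos
  have e : ‖(1 / (2 * π) : ℂ)‖ = 1 / (2 * π) := by
    rw [show (1 / (2 * π) : ℂ) = ((1 / (2 * π) : ℝ) : ℂ) by push_cast; ring, Complex.norm_real,
      Real.norm_of_nonneg (by positivity)]
  rw [e]
  refine mul_le_mul_of_nonneg_left ?_ (by positivity)
  refine intervalIntegral.norm_integral_le_of_norm_le (by positivity) ?_ ?_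
  · refine Filter.Eventually.of_forall fun x _ => ?_
    rw [Pi.mul_apply, norm_mul, pkC, Complex.norm_real, Real.norm_of_nonneg (pk_nonneg ht x)]
    exact mul_le_mul_of_nonneg_right (hb x) (pk_nonneg ht x)
  · apply Continuous.intervalIntegrable
    have := pk_cont ht
    fun_prop

lemma korovkin {c : ℝ → ℂ} (hc : c ∈ CtsT) {ε : ℝ} (hε : 0 < ε) :
    ∃ B, 0 ≤ B ∧ ∀ x, ‖c x - c 0‖ ≤ ε + B * (1 - Real.cos x) := by
  obtain ⟨C, hC⟩ := periodic_bdd hc.1 hc.2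
  obtain ⟨δ, hδ, hδ'⟩ := Metric.continuous_iff.1 hc.2 0 ε hε
  set d := min δ π / 2 with hd
  have hpi := Real.pi_pos
  have hd0 : 0 < d := by positivity
  have hdδ : d < δ := by have := min_le_left δ π; linarith
  have hdp : d < π := by have := min_le_right δ π; linarith
  have hcosd : Real.cos d < 1 := by
    rw [← Real.cos_zero]; exact Real.cos_lt_cos_of_nonneg_of_le_pi le_rfl hdp.le hd0
  have hC0 : 0 ≤ C := (norm_nonneg _).trans (hC 0)
  refine ⟨2 * C / (1 - Real.cos d), div_nonneg (by linarith) (by linarith), fun x => ?_⟩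
  obtain ⟨y, hy, hxy⟩ : ∃ y ∈ Set.Icc (-π) π, c x = c y ∧ Real.cos x = Real.cos y := by
    have hp : Function.Periodic (fun x => (c x, Real.cos x)) (2 * π) := fun x => by
      simp [hc.1 x]
    obtain ⟨y, hy, hxy⟩ := hp.exists_mem_Ico Real.two_pi_pos x (-π)
    simp only [Prod.mk.injEq] at hxy
    exact ⟨y, ⟨hy.1, by linarith [hy.2]⟩, hxy⟩
  rw [hxy.1, hxy.2]
  have hcy := Real.cos_le_one y
  rcases lt_or_ge |y| δ with h | h
  · have := hδ' y (by simpa using h)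
    rw [dist_eq_norm] at this
    have : 0 ≤ 2 * C / (1 - Real.cos d) * (1 - Real.cos y) :=
      mul_nonneg (div_nonneg (by linarith) (by linarith)) (by linarith)
    linarith
  · have h1 : Real.cos y ≤ Real.cos d := by
      rw [← Real.cos_abs y]
      exact Real.cos_le_cos_of_nonneg_of_le_pi hd0.le (abs_le.2 hy) (by linarith)
    have h2 : ‖c y - c 0‖ ≤ 2 * C := (norm_sub_le _ _).trans (by linarith [hC y, hC 0])
    have h3 : 2 * C ≤ 2 * C / (1 - Real.cos d) * (1 - Real.cos y) := by
      rw [div_mul_eq_mul_div, le_div_iff₀ (by linarith)]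
      exact mul_le_mul_of_nonneg_left (by linarith) (by linarith)
    linarith

lemma ev_lt_one : ∀ᶠ t : ℝ in 𝓝[<] 1, |t| < 1 := by
  filter_upwards [Ioo_mem_nhdsLT (show (-1 : ℝ) < 1 by norm_num)] with t ht
  exact abs_lt.2 ht

lemma PP_cts_mul {c g : ℝ → ℂ} (hc : c ∈ CtsT) (hg : g ∈ LinfT) :
    Tendsto (fun t => PP (c * g) t - c 0 * PP g t) (𝓝[<] 1) (𝓝 0) := by
  obtain ⟨G, hG⟩ := hg.2.2
  have hG0 : 0 ≤ G := (norm_nonneg _).trans (hG 0)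
  rw [Metric.tendsto_nhds]
  intro ε hε
  obtain ⟨B, hB0, hB⟩ := korovkin hc (ε := ε / 2 / (G + 1)) (by positivity)
  have hlim : Tendsto (fun t : ℝ => G * (ε / 2 / (G + 1)) + G * B * (1 - t)) (𝓝[<] 1)
      (𝓝 (G * (ε / 2 / (G + 1)) + G * B * (1 - 1))) := by
    apply Tendsto.mono_left _ nhdsWithin_le_nhds
    exact Continuous.tendsto (by fun_prop) 1
  have hlt : G * (ε / 2 / (G + 1)) + G * B * (1 - 1) < ε := by
    have : G * (ε / 2 / (G + 1)) ≤ ε / 2 := by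
      rw [mul_div_assoc', div_le_iff₀ (by positivity)]; nlinarith
    linarith
  filter_upwards [ev_lt_one, hlim.eventually_lt_const hlt] with t ht h1
  rw [dist_zero_right]
  refine lt_of_le_of_lt ?_ h1
  rw [← PP_smul, ← PP_sub (linf_mul (linf_of_cts hc) hg) (linf_smul _ hg) ht]
  apply PP_bound ht
  intro x
  have : (c * g - c 0 • g) x = (c x - c 0) * g x := by
    simp; ring
  rw [this, norm_mul]
  calc ‖c x - c 0‖ * ‖g x‖ ≤ (ε / 2 / (G + 1) + B * (1 - Real.cos x)) * G :=
        mul_le_mul (hB x) (hG x) (norm_nonneg _) ((norm_nonneg _).trans (hB x))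
    _ = _ := by ring

lemma PP_one {t : ℝ} (ht : |t| < 1) : PP 1 t = 1 := by
  have h0 : ex 0 = 1 := by ext x; simp [ex]
  rw [← h0, PP_ex ht]; simp

lemma PP_cts {c : ℝ → ℂ} (hc : c ∈ CtsT) : Tendsto (fun t => PP c t) (𝓝[<] 1) (𝓝 (c 0)) := by
  have h := PP_cts_mul hc (linf_const 1)
  have h2 : Tendsto (fun t => PP c t - c 0) (𝓝[<] 1) (𝓝 0) := by
    refine h.congr' ?_
    filter_upwards [ev_lt_one] with t ht
    rw [show (fun _ => 1 : ℝ → ℂ) = 1 from rfl, PP_one ht]; simp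
  simpa using h2.add_const (c 0)

lemma PP_norm_le {f : ℝ → ℂ} {C t : ℝ} (ht : |t| < 1) (hC : ∀ x, ‖f x‖ ≤ C) : ‖PP f t‖ ≤ C := by
  have := PP_bound (f := f) (A := C) (B := 0) ht (by simpa using hC)
  simpa using this

end QCP

namespace QCP

open Complex (I)

/-- `C + H^∞` -/
def CH : Set (ℝ → ℂ) := {f | ∃ c ∈ CtsT, ∃ h ∈ HinfT, f = c + h}

lemma CH_linf {f : ℝ → ℂ} (hf : f ∈ CH) : f ∈ LinfT := by
  obtain ⟨c, hc, h, hh, rfl⟩ := hf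
  exact linf_add (linf_of_cts hc) hh.1

lemma cts_cj {c : ℝ → ℂ} (hc : c ∈ CtsT) : cj c ∈ CtsT :=
  ⟨(linf_cj (linf_of_cts hc)).1, Complex.continuous_conj.comp hc.2⟩

lemma cts_sh {c : ℝ → ℂ} (θ : ℝ) (hc : c ∈ CtsT) : sh θ c ∈ CtsT :=
  ⟨(linf_sh θ (linf_of_cts hc)).1, hc.2.comp (continuous_id.add continuous_const)⟩

lemma hinf_sh {h : ℝ → ℂ} (θ : ℝ) (hh : h ∈ HinfT) : sh θ h ∈ HinfT :=
  ⟨linf_sh θ hh.1, fun n hn => by rw [fc_sh hh.1, hh.2 n hn, mul_zero]⟩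

lemma hinfBar_sh {h : ℝ → ℂ} (θ : ℝ) (hh : h ∈ HinfBarT) : sh θ h ∈ HinfBarT :=
  ⟨linf_sh θ hh.1, fun n hn => by rw [fc_sh hh.1, hh.2 n hn, mul_zero]⟩

lemma hinf_cj {h : ℝ → ℂ} (hh : h ∈ HinfT) : cj h ∈ HinfBarT :=
  ⟨linf_cj hh.1, fun n hn => by rw [fc_cj, hh.2 (-n) (by omega), map_zero]⟩

lemma hinfBar_cj {h : ℝ → ℂ} (hh : h ∈ HinfBarT) : cj h ∈ HinfT :=
  ⟨linf_cj hh.1, fun n hn => by rw [fc_cj, hh.2 (-n) (by omega), map_zero]⟩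

lemma qc_iff (f : ℝ → ℂ) : f ∈ QCset ↔ f ∈ CH ∧ cj f ∈ CH := by
  constructor
  · rintro ⟨h1, c, hc, h, hh, rfl⟩
    exact ⟨h1, cj c, cts_cj hc, cj h, hinfBar_cj hh, cj_add _ _⟩
  · rintro ⟨h1, c, hc, h, hh, e⟩
    refine ⟨h1, cj c, cts_cj hc, cj h, hinf_cj hh, ?_⟩
    rw [← cj_add, ← e, cj_cj]

lemma qc_linf {f : ℝ → ℂ} (hf : f ∈ QCset) : f ∈ LinfT := CH_linf ((qc_iff f).1 hf).1

lemma qc_sh {f : ℝ → ℂ} (θ : ℝ) (hf : f ∈ QCset) : sh θ f ∈ QCset := by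
  obtain ⟨⟨c, hc, h, hh, e⟩, ⟨c', hc', h', hh', e'⟩⟩ := hf
  refine ⟨⟨sh θ c, cts_sh θ hc, sh θ h, hinf_sh θ hh, ?_⟩, ⟨sh θ c', cts_sh θ hc', sh θ h', hinfBar_sh θ hh', ?_⟩⟩
  · rw [e]; rfl
  · rw [e']; rfl

lemma PP_bddUnder {f : ℝ → ℂ} (hf : f ∈ LinfT) :
    Filter.IsBoundedUnder (· ≤ ·) (𝓝[<] (1 : ℝ)) ((norm) ∘ fun t => PP f t) := by
  obtain ⟨C, hC⟩ := hf.2.2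
  refine Filter.isBoundedUnder_of_eventually_le (a := C) ?_
  filter_upwards [ev_lt_one] with t ht
  exact PP_norm_le ht hC

lemma CH_asym {f g : ℝ → ℂ} (hf : f ∈ CH) (hg : g ∈ CH) :
    Tendsto (fun t => PP (f * g) t - PP f t * PP g t) (𝓝[<] 1) (𝓝 0) := by
  have hgl := CH_linf hg
  obtain ⟨c, hc, h, hh, rfl⟩ := hf
  obtain ⟨d, hd, k, hk, rfl⟩ := hg
  have hcl := linf_of_cts hc
  have hdl := linf_of_cts hd
  have a1 := PP_cts_mul hc hgl
  have a2 := PP_cts_mul hd hh.1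
  have a3 : Tendsto (fun t => (c 0 - PP c t) * PP (d + k) t) (𝓝[<] 1) (𝓝 0) := by
    refine Filter.Tendsto.zero_mul_isBoundedUnder_le ?_ (PP_bddUnder hgl)
    simpa using (tendsto_const_nhds (x := c 0)).sub (PP_cts hc)
  have a4 : Tendsto (fun t => (d 0 - PP d t) * PP h t) (𝓝[<] 1) (𝓝 0) := by
    refine Filter.Tendsto.zero_mul_isBoundedUnder_le ?_ (PP_bddUnder hh.1)
    simpa using (tendsto_const_nhds (x := d 0)).sub (PP_cts hd)
  have a := ((a1.add a2).add a3).add a4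
  simp only [add_zero] at a
  refine a.congr' ?_
  filter_upwards [ev_lt_one] with t ht
  have e1 : (c + h) * (d + k) = c * (d + k) + (d * h + h * k) := by ring
  rw [e1, PP_add (linf_mul hcl hgl) (linf_add (linf_mul hdl hh.1) (linf_mul hh.1 hk.1)) ht,
    PP_add (linf_mul hdl hh.1) (linf_mul hh.1 hk.1) ht, PP_mul hh hk ht, PP_add hcl hh.1 ht,
    PP_add hdl hk.1 ht]
  ring

/-- squared deviation -/
def dev (q : ℝ → ℂ) (a : ℂ) : ℝ → ℂ := (q - fun _ => a) * cj (q - fun _ => a)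

lemma dev_linf {q : ℝ → ℂ} (hq : q ∈ LinfT) (a : ℂ) : dev q a ∈ LinfT :=
  linf_mul (linf_sub hq (linf_const a)) (linf_cj (linf_sub hq (linf_const a)))

lemma dev_apply (q : ℝ → ℂ) (a : ℂ) (x : ℝ) : dev q a x = ((‖q x - a‖ ^ 2 : ℝ) : ℂ) := by
  simp only [dev, cj, Pi.mul_apply, Pi.sub_apply]
  rw [Complex.mul_conj, Complex.normSq_eq_norm_sq]

lemma PP_dev {q : ℝ → ℂ} (hq : q ∈ QCset) :
    Tendsto (fun t => PP (dev q (PP q t)) t) (𝓝[<] 1) (𝓝 0) := by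
  have hl := qc_linf hq
  obtain ⟨h1, h2⟩ := (qc_iff q).1 hq
  refine (CH_asym h1 h2).congr' ?_
  filter_upwards [ev_lt_one] with t ht
  set a := PP q t
  have e : dev q a = q * cj q - (a • cj q + (starRingEnd ℂ a) • q - (a * starRingEnd ℂ a) • 1) := by
    ext x; simp [dev, cj]; ring
  have l1 : (1 : ℝ → ℂ) ∈ LinfT := linf_const 1
  rw [e, PP_sub (linf_mul hl (linf_cj hl)) (linf_sub (linf_add (linf_smul _ (linf_cj hl)) (linf_smul _ hl)) (linf_smul _ l1)) ht,
    PP_sub (linf_add (linf_smul _ (linf_cj hl)) (linf_smul _ hl)) (linf_smul _ l1) ht,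
    PP_add (linf_smul _ (linf_cj hl)) (linf_smul _ hl) ht, PP_smul, PP_smul, PP_smul, PP_one ht, PP_cj]
  change _ = PP (q * cj q) t - (a * (starRingEnd ℂ) a + (starRingEnd ℂ) a * a - a * (starRingEnd ℂ) a * 1)
  ring

lemma pk_lower {lam x : ℝ} (hl : 1 ≤ lam) (hx : |x| ≤ π / lam) :
    lam / (1 + π ^ 2) ≤ pk (1 - 1 / lam) x := by
  have hl0 : 0 < lam := by linarith
  set s := 1 / lam with hs
  have hs0 : 0 < s := by positivity
  have hs1 : s ≤ 1 := by rw [hs, div_le_one hl0]; exact hl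
  have hlam : lam = 1 / s := by rw [hs]; field_simp
  have hx2 : x ^ 2 ≤ π ^ 2 * s ^ 2 := by
    have : |x| ≤ π * s := by rw [hs]; simpa [div_eq_mul_inv] using hx
    rw [← sq_abs x, ← mul_pow]
    exact pow_le_pow_left₀ (abs_nonneg x) this 2
  have hcos := Real.one_sub_sq_div_two_le_cos (x := x)
  have hden : 1 - 2 * (1 - s) * Real.cos x + (1 - s) ^ 2 ≤ (1 + π ^ 2) * s ^ 2 := by
    nlinarith [sq_nonneg x]
  have hden0 := pk_den_pos (t := 1 - s) (by rw [abs_lt]; constructor <;> linarith) x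
  rw [pk, div_le_div_iff₀ (by positivity) hden0, hlam]
  have h1 : 1 / s * (1 - 2 * (1 - s) * Real.cos x + (1 - s) ^ 2) ≤ 1 / s * ((1 + π ^ 2) * s ^ 2) :=
    mul_le_mul_of_nonneg_left hden (by positivity)
  refine h1.trans ?_
  rw [show 1 / s * ((1 + π ^ 2) * s ^ 2) = s * (1 + π ^ 2) by field_simp]
  exact mul_le_mul_of_nonneg_right (by nlinarith) (by positivity)

/-- average absolute deviation -/
def DD (q : ℝ → ℂ) (a : ℂ) (lam : ℝ) : ℝ :=
  (lam / (2 * π)) * ∫ x in (-(π / lam))..(π / lam), ‖q x - a‖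

lemma DD_le {q : ℝ → ℂ} (hq : q ∈ LinfT) (a : ℂ) {lam η : ℝ} (hl : 1 ≤ lam) (hη : 0 < η) :
    DD q a lam ≤ η + (1 + π ^ 2) / η * ‖PP (dev q a) (1 - 1 / lam)‖ := by
  have hpi := Real.pi_pos
  have hl0 : 0 < lam := by linarith
  have hle : -(π / lam) ≤ π / lam := by have : 0 < π / lam := by positivity
                                        linarith
  have hpl : π / lam ≤ π := div_le_self hpi.le hl
  have ht : |1 - 1 / lam| < 1 := by
    have : 1 / lam ≤ 1 := by rw [div_le_one hl0]; exact hl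
    have : 0 < 1 / lam := by positivity
    rw [abs_lt]; constructor <;> linarith
  have hI : ∀ f : ℝ → ℂ, f ∈ LinfT → ∀ u v : ℝ, IntervalIntegrable (fun x => ‖f x‖) volume u v :=
    fun f hf u v => (linf_int hf u v).norm
  set P := pk (1 - 1 / lam)
  have hPl := pkC_linf ht
  have hdev := dev_linf hq a
  -- integrability
  have i1 : IntervalIntegrable (fun x => ‖q x - a‖) volume (-(π / lam)) (π / lam) :=
    hI _ (linf_sub hq (linf_const a)) _ _
  have i3 : ∀ u v : ℝ, IntervalIntegrable (fun x => ‖q x - a‖ ^ 2 * P x) volume u v := by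
    intro u v
    have := hI _ (linf_mul hdev hPl) u v
    refine this.congr (fun x _ => ?_)
    simp only [Pi.mul_apply, dev_apply, norm_mul, pkC, Complex.norm_real]
    rw [Real.norm_of_nonneg (by positivity), Real.norm_of_nonneg (pk_nonneg ht x)]
  -- total Poisson integral
  have hper : Function.Periodic (fun x => ‖q x - a‖ ^ 2 * P x) (2 * π) := by
    intro x
    have := hq.1 x
    simp only [this, P, pk, Real.cos_add_two_pi]
  have tot : (1 / (2 * π)) * ∫ x in (-π)..π, ‖q x - a‖ ^ 2 * P x = ‖PP (dev q a) (1 - 1 / lam)‖ := by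
    have e1 : ∫ x in (-π)..π, ‖q x - a‖ ^ 2 * P x = ∫ x in (0:ℝ)..(2 * π), ‖q x - a‖ ^ 2 * P x := by
      have := hper.intervalIntegral_add_eq (-π) 0
      rw [show -π + 2 * π = π by ring, zero_add] at this
      exact this
    have e2 : PP (dev q a) (1 - 1 / lam) =
        (((1 / (2 * π)) * ∫ x in (0:ℝ)..(2 * π), ‖q x - a‖ ^ 2 * P x : ℝ) : ℂ) := by
      rw [PP, mn, Complex.ofReal_mul, ← intervalIntegral.integral_ofReal]
      push_cast
      congr 1
      apply intervalIntegral.integral_congr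
      intro x _
      simp only [Pi.mul_apply, dev_apply, pkC]
      push_cast
      rfl
    rw [e1, e2, Complex.norm_real, Real.norm_of_nonneg]
    refine mul_nonneg (by positivity) (intervalIntegral.integral_nonneg (by positivity) fun x _ => ?_)
    exact mul_nonneg (by positivity) (pk_nonneg ht x)
  have step1 : ∫ x in (-(π / lam))..(π / lam), ‖q x - a‖ ≤
      ∫ x in (-(π / lam))..(π / lam), (η + (1 + π ^ 2) / (η * lam) * (‖q x - a‖ ^ 2 * P x)) := by
    refine intervalIntegral.integral_mono_on hle i1 ?_ ?_
    · exact (intervalIntegrable_const).add ((i3 _ _).const_mul _)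
    · intro x hx
      have hP := pk_lower hl (abs_le.2 hx)
      have hn := norm_nonneg (q x - a)
      have h1 : ‖q x - a‖ ≤ η + ‖q x - a‖ ^ 2 / η := by
        rw [← sub_le_iff_le_add', le_div_iff₀ hη]
        nlinarith [sq_nonneg (‖q x - a‖ - η), sq_nonneg (‖q x - a‖)]
      refine h1.trans ?_
      have h2 : ‖q x - a‖ ^ 2 / η = (1 + π ^ 2) / (η * lam) * (‖q x - a‖ ^ 2 * (lam / (1 + π ^ 2))) := by
        field_simp
      rw [h2]
      gcongr
  have step2 : ∫ x in (-(π / lam))..(π / lam), ‖q x - a‖ ^ 2 * P x ≤ ∫ x in (-π)..π, ‖q x - a‖ ^ 2 * P x := by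
    refine intervalIntegral.integral_mono_interval (by linarith) hle hpl ?_ (i3 _ _)
    exact Filter.Eventually.of_forall fun x => mul_nonneg (by positivity) (pk_nonneg ht x)
  rw [intervalIntegral.integral_add intervalIntegrable_const ((i3 _ _).const_mul _),
    intervalIntegral.integral_const, intervalIntegral.integral_const_mul] at step1
  rw [← tot, DD]
  have step3 := mul_le_mul_of_nonneg_left step2 (show 0 ≤ (1 + π ^ 2) / (η * lam) by positivity)
  calc _ ≤ lam / (2 * π) * ((π / lam - -(π / lam)) • η + (1 + π ^ 2) / (η * lam) * ∫ x in (-π)..π, ‖q x - a‖ ^ 2 * P x) :=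
        mul_le_mul_of_nonneg_left (by linarith) (by positivity)
    _ = _ := by
        rw [smul_eq_mul]
        field_simp
        ring

lemma DD_nonneg (q : ℝ → ℂ) (a : ℂ) {lam : ℝ} (hl : 1 ≤ lam) : 0 ≤ DD q a lam := by
  have hpi := Real.pi_pos
  have : 0 < π / lam := by positivity
  exact mul_nonneg (by positivity) (intervalIntegral.integral_nonneg (by linarith) fun x _ => norm_nonneg _)

lemma tendsto_r : Tendsto (fun lam : ℝ => 1 - 1 / lam) atTop (𝓝[<] 1) := by
  rw [tendsto_nhdsWithin_iff]
  constructor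
  · have := (tendsto_inv_atTop_zero (𝕜 := ℝ)).const_sub 1
    simpa using this
  · filter_upwards [eventually_ge_atTop 1] with lam hl
    have : 0 < 1 / lam := by positivity
    simp only [Set.mem_Iio]; linarith

lemma DD_tendsto {q : ℝ → ℂ} (hq : q ∈ QCset) :
    Tendsto (fun lam => DD q (PP q (1 - 1 / lam)) lam) atTop (𝓝 0) := by
  have h := ((PP_dev hq).comp tendsto_r).norm
  simp only [norm_zero, Function.comp_def] at h
  rw [Metric.tendsto_nhds]
  intro ε hε
  have h2 := h.const_mul ((1 + π ^ 2) / (ε / 2))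
  rw [mul_zero] at h2
  filter_upwards [eventually_ge_atTop 1, h2.eventually_lt_const (show 0 < ε / 2 by positivity)] with lam hl h3
  rw [Real.dist_eq, sub_zero, abs_of_nonneg (DD_nonneg _ _ hl)]
  have := DD_le (qc_linf hq) (PP q (1 - 1 / lam)) hl (show 0 < ε / 2 by positivity)
  linarith

end QCP

namespace QCP
open Complex (I)

lemma mv_sh (f : ℝ → ℂ) (lam θ : ℝ) : movAvg f lam θ = movAvg (sh θ f) lam 0 := by
  simp only [movAvg, sh]
  rw [intervalIntegral.integral_comp_add_right (fun x => f x) θ]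
  congr 2 <;> ring

lemma mv_add {f g : ℝ → ℂ} (hf : f ∈ LinfT) (hg : g ∈ LinfT) (lam θ : ℝ) :
    movAvg (f + g) lam θ = movAvg f lam θ + movAvg g lam θ := by
  simp only [movAvg, Pi.add_apply]
  rw [intervalIntegral.integral_add (linf_int hf _ _) (linf_int hg _ _)]
  ring

lemma mv_smul (c : ℂ) (f : ℝ → ℂ) (lam θ : ℝ) :
    movAvg (c • f) lam θ = c * movAvg f lam θ := by
  simp only [movAvg, Pi.smul_apply, smul_eq_mul]
  rw [intervalIntegral.integral_const_mul]
  ring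

lemma mv_const (c : ℂ) {lam : ℝ} (hl : 1 ≤ lam) (θ : ℝ) :
    movAvg (fun _ => c) lam θ = c := by
  have hl0 : (lam : ℂ) ≠ 0 := by
    have : lam ≠ 0 := by linarith
    exact_mod_cast this
  have hpi : (π : ℂ) ≠ 0 := by exact_mod_cast Real.pi_ne_zero
  simp only [movAvg, intervalIntegral.integral_const]
  rw [Complex.real_smul]
  push_cast
  field_simp
  ring

lemma mv_le {q g : ℝ → ℂ} (hq : q ∈ LinfT) (a : ℂ) {C lam : ℝ} (hC : ∀ x, ‖g x‖ ≤ C)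
    (hl : 1 ≤ lam) : ‖movAvg ((q - fun _ => a) * g) lam 0‖ ≤ C * DD q a lam := by
  have hpi := Real.pi_pos
  have h0 : 0 < π / lam := by positivity
  have hC0 : 0 ≤ C := (norm_nonneg _).trans (hC 0)
  simp only [movAvg, DD, zero_sub, zero_add]
  rw [norm_mul]
  have e : ‖((lam : ℂ) / (2 * π))‖ = lam / (2 * π) := by
    rw [show ((lam : ℂ) / (2 * π)) = ((lam / (2 * π) : ℝ) : ℂ) by push_cast; rfl,
      Complex.norm_real, Real.norm_of_nonneg (by positivity)]
  rw [e, mul_left_comm]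
  refine mul_le_mul_of_nonneg_left ?_ (by positivity)
  rw [← intervalIntegral.integral_const_mul]
  refine intervalIntegral.norm_integral_le_of_norm_le (by linarith) ?_ ?_
  · refine Filter.Eventually.of_forall fun x _ => ?_
    simp only [Pi.mul_apply, Pi.sub_apply, norm_mul]
    rw [mul_comm]
    exact mul_le_mul_of_nonneg_right (hC x) (norm_nonneg _)
  · exact ((linf_int (linf_sub hq (linf_const a)) _ _).norm).const_mul C

lemma mv_norm {f : ℝ → ℂ} {C lam : ℝ} (hC : ∀ x, ‖f x‖ ≤ C)
    (hl : 1 ≤ lam) (θ : ℝ) : ‖movAvg f lam θ‖ ≤ C := by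
  have hpi := Real.pi_pos
  have h0 : 0 < π / lam := by positivity
  simp only [movAvg]
  rw [norm_mul]
  have e : ‖((lam : ℂ) / (2 * π))‖ = lam / (2 * π) := by
    rw [show ((lam : ℂ) / (2 * π)) = ((lam / (2 * π) : ℝ) : ℂ) by push_cast; rfl,
      Complex.norm_real, Real.norm_of_nonneg (by positivity)]
  rw [e]
  have := intervalIntegral.norm_integral_le_of_norm_le_const (a := θ - π / lam) (b := θ + π / lam)
    (f := f) (C := C) (fun x _ => hC x)
  have e2 : |θ + π / lam - (θ - π / lam)| = 2 * (π / lam) := by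
    rw [abs_of_nonneg (by linarith)]; ring
  rw [e2] at this
  calc _ ≤ lam / (2 * π) * (C * (2 * (π / lam))) := mul_le_mul_of_nonneg_left this (by positivity)
    _ = C := by field_simp

lemma mv_sub_le {q : ℝ → ℂ} (hq : q ∈ LinfT) (a : ℂ) {lam : ℝ}
    (hl : 1 ≤ lam) : ‖movAvg q lam 0 - a‖ ≤ DD q a lam := by
  have h := mv_le (g := fun _ => 1) hq a (C := 1) (by simp) hl
  rw [one_mul] at h
  refine le_of_eq_of_le ?_ h
  have h2 : movAvg q lam 0 = movAvg (q - fun _ => a) lam 0 + movAvg (fun _ => a) lam 0 := by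
    rw [← mv_add (linf_sub hq (linf_const a)) (linf_const a), sub_add_cancel]
  rw [h2, mv_const a hl, add_sub_cancel_right]
  congr 2
  ext x; simp

lemma mv_PP {q : ℝ → ℂ} (hq : q ∈ QCset) :
    Tendsto (fun lam => movAvg q lam 0 - PP q (1 - 1 / lam)) atTop (𝓝 0) := by
  refine squeeze_zero_norm' ?_ (DD_tendsto hq)
  filter_upwards [eventually_ge_atTop 1] with lam hl
  exact mv_sub_le (qc_linf hq) _ hl

lemma mv_mul0 {p q : ℝ → ℂ} (hp : p ∈ QCset) (hq : q ∈ QCset) :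
    Tendsto (fun lam => movAvg (p * q) lam 0 - movAvg p lam 0 * movAvg q lam 0) atTop (𝓝 0) := by
  have hpl := qc_linf hp
  have hql := qc_linf hq
  obtain ⟨C, hC⟩ := hpl.2.2
  obtain ⟨D, hD⟩ := hql.2.2
  have hC0 : 0 ≤ C := (norm_nonneg _).trans (hC 0)
  have lim := ((DD_tendsto hp).const_mul (2 * D))
  rw [mul_zero] at lim
  refine squeeze_zero_norm' ?_ lim
  filter_upwards [eventually_ge_atTop 1] with lam hl
  set a := PP p (1 - 1 / lam) with ha
  have h1 := mv_le hpl a hD hl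
  have h2 := mv_sub_le hpl a hl
  have h3 := mv_norm hD hl 0
  have e : p * q = (p - fun _ => a) * q + a • q := by
    ext x; simp; ring
  have e2 : movAvg (p * q) lam 0 - movAvg p lam 0 * movAvg q lam 0
      = movAvg ((p - fun _ => a) * q) lam 0 - (movAvg p lam 0 - a) * movAvg q lam 0 := by
    conv_lhs => rw [e]
    rw [mv_add (linf_mul (linf_sub hpl (linf_const a)) hql) (linf_smul a hql), mv_smul]
    ring
  rw [e2]
  calc _ ≤ _ := norm_sub_le _ _
    _ ≤ D * DD p a lam + DD p a lam * D := by
        rw [norm_mul]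
        exact add_le_add h1 (mul_le_mul h2 h3 (norm_nonneg _) (DD_nonneg _ _ hl))
    _ = _ := by ring

lemma mv_mul {p q : ℝ → ℂ} (hp : p ∈ QCset) (hq : q ∈ QCset) (θ : ℝ) :
    Tendsto (fun lam => movAvg (p * q) lam θ - movAvg p lam θ * movAvg q lam θ) atTop (𝓝 0) := by
  have := mv_mul0 (qc_sh θ hp) (qc_sh θ hq)
  refine this.congr fun lam => ?_
  rw [mv_sh (p * q), mv_sh p, mv_sh q]
  rfl

lemma mv_ultra {f : ℝ → ℂ} (hf : f ∈ LinfT) (θ : ℝ) (U : Ultrafilter ℝ) (hU : (U : Filter ℝ) ≤ atTop) :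
    ∃ l, Tendsto (fun lam => movAvg f lam θ) U (𝓝 l) := by
  obtain ⟨C, hC⟩ := hf.2.2
  have hc := (isCompact_closedBall (0 : ℂ) C).ultrafilter_le_nhds (U.map (fun lam => movAvg f lam θ)) ?_
  · obtain ⟨l, _, h⟩ := hc
    exact ⟨l, h⟩
  · rw [Filter.le_principal_iff]
    have : ∀ᶠ lam in (U : Filter ℝ), movAvg f lam θ ∈ Metric.closedBall (0 : ℂ) C := by
      filter_upwards [hU (eventually_ge_atTop 1)] with lam hl
      rw [mem_closedBall_zero_iff]
      exact mv_norm hC hl θ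
    exact this

def xi (θ : ℝ) (U : Ultrafilter ℝ) (f : ℝ → ℂ) : ℂ := limUnder (U : Filter ℝ) (fun lam => movAvg f lam θ)

lemma xi_tendsto {f : ℝ → ℂ} (hf : f ∈ LinfT) (θ : ℝ) (U : Ultrafilter ℝ)
    (hU : (U : Filter ℝ) ≤ atTop) :
    Tendsto (fun lam => movAvg f lam θ) U (𝓝 (xi θ U f)) :=
  tendsto_nhds_limUnder (mv_ultra hf θ U hU)

lemma xi_InM0 (θ : ℝ) (U : Ultrafilter ℝ) (hU : (U : Filter ℝ) ≤ atTop) : InM0 QCset θ (xi θ U) := by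
  have T := fun (f : ℝ → ℂ) (hf : f ∈ QCset) => xi_tendsto (qc_linf hf) θ U hU
  refine ⟨⟨?_, ?_, ?_, ?_, ?_⟩, ?_⟩
  · intro p hp q hq
    refine tendsto_nhds_unique (xi_tendsto (linf_add (qc_linf hp) (qc_linf hq)) θ U hU) ?_
    exact ((T p hp).add (T q hq)).congr fun lam => (mv_add (qc_linf hp) (qc_linf hq) _ _).symm
  · intro p hp q hq
    refine tendsto_nhds_unique (xi_tendsto (linf_mul (qc_linf hp) (qc_linf hq)) θ U hU) ?_
    have := ((mv_mul hp hq θ).mono_left hU).add ((T p hp).mul (T q hq))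
    rw [zero_add] at this
    exact this.congr fun lam => by ring
  · intro c q hq
    refine tendsto_nhds_unique (xi_tendsto (linf_smul c (qc_linf hq)) θ U hU) ?_
    exact ((T q hq).const_mul c).congr fun lam => (mv_smul c q _ _).symm
  · refine tendsto_nhds_unique (xi_tendsto (linf_const 1) θ U hU) ?_
    refine (tendsto_const_nhds (x := (1 : ℂ))).congr' ?_
    filter_upwards [hU (eventually_ge_atTop 1)] with lam hl
    exact (mv_const 1 hl θ).symm
  · intro q hq C hC
    refine le_of_tendsto (T q hq).norm ?_
    filter_upwards [hU (eventually_ge_atTop 1)] with lam hl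
    exact mv_norm hC hl θ
  · intro qs hqs ε hε
    have : ∀ᶠ lam in (U : Filter ℝ), ∀ q ∈ qs, ‖xi θ U q - movAvg q lam θ‖ < ε := by
      induction qs with
      | nil => simp
      | cons p qs ih =>
        have h1 := ih (fun q hq => hqs q (List.mem_cons_of_mem _ hq))
        have h2 := (Metric.tendsto_nhds.1 (T p (hqs p List.mem_cons_self))) ε hε
        filter_upwards [h1, h2] with lam h1 h2 q hq
        rcases List.mem_cons.1 hq with rfl | hq
        · rw [dist_comm, dist_eq_norm] at h2; exact h2
        · exact h1 q hq
    obtain ⟨lam, h1, h2⟩ := (this.and (hU (eventually_ge_atTop 1))).exists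
    exact ⟨lam, h2, h1⟩

lemma mv_zero {q : ℝ → ℂ} (hq : q ∈ QCset) (θ : ℝ) (h : ∀ ξ, InM0 QCset θ ξ → ξ q = 0) :
    Tendsto (fun lam => movAvg q lam θ) atTop (𝓝 0) := by
  rw [tendsto_iff_ultrafilter]
  intro U hU
  have := xi_tendsto (qc_linf hq) θ U hU
  rwa [h _ (xi_InM0 θ U hU)] at this

lemma PP_zero0 {q : ℝ → ℂ} (hq : q ∈ QCset) (h : Tendsto (fun lam => movAvg q lam 0) atTop (𝓝 0)) :
    Tendsto (PP q) (𝓝[<] 1) (𝓝 0) := by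
  have h1 := h.sub (mv_PP hq)
  simp only [sub_sub_cancel, sub_zero] at h1
  have h2 : Tendsto (fun t : ℝ => (1 - t)⁻¹) (𝓝[<] 1) atTop := by
    refine tendsto_inv_nhdsGT_zero.comp ?_
    rw [tendsto_nhdsWithin_iff]
    constructor
    · have : Tendsto (fun t : ℝ => 1 - t) (𝓝 1) (𝓝 (1 - 1)) := tendsto_const_nhds.sub tendsto_id
      rw [sub_self] at this
      exact this.mono_left nhdsWithin_le_nhds
    · filter_upwards [self_mem_nhdsWithin] with t ht
      exact sub_pos.2 (Set.mem_Iio.1 ht)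
  refine (h1.comp h2).congr fun t => ?_
  simp

lemma PP_zero {q : ℝ → ℂ} (hq : q ∈ QCset) (h1 : ∀ ξ, InM0 QCset 0 ξ → ξ q = 0)
    (h2 : ∀ ξ, InM0 QCset π ξ → ξ q = 0) :
    Tendsto (PP q) (𝓝[<] 1) (𝓝 0) ∧ Tendsto (fun t => PP q (-t)) (𝓝[<] 1) (𝓝 0) := by
  refine ⟨PP_zero0 hq (mv_zero hq 0 h1), ?_⟩
  have := PP_zero0 (qc_sh π hq) ((mv_zero hq π h2).congr fun lam => mv_sh _ _ _)
  refine this.congr' ?_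
  filter_upwards [ev_lt_one] with t ht
  exact PP_sh_pi (qc_linf hq) ht

end QCP

namespace QCP
open Complex (I)

def KK (t x : ℝ) : ℂ :=
  (1 - Complex.exp (I * x) ^ 2) * (1 - t ^ 2) / ((1 - Complex.exp (I * x) * t) ^ 2 * (Complex.exp (I * x) - t))

lemma expI_eq (x : ℝ) : Complex.exp (I * x) = ⟨Real.cos x, Real.sin x⟩ := by
  apply Complex.ext
  · rw [mul_comm, Complex.exp_ofReal_mul_I_re]
  · rw [mul_comm, Complex.exp_ofReal_mul_I_im]

lemma n1 (t x : ℝ) : ‖Complex.exp (I * x) - t‖ ^ 2 = (t - Real.cos x) ^ 2 + Real.sin x ^ 2 := by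
  rw [Complex.sq_norm, Complex.normSq_apply, expI_eq]
  simp
  ring

lemma n2 (t x : ℝ) : ‖1 - Complex.exp (I * x) * t‖ = ‖Complex.exp (I * x) - t‖ := by
  rw [← sq_eq_sq₀ (norm_nonneg _) (norm_nonneg _), n1, Complex.sq_norm, Complex.normSq_apply, expI_eq]
  simp
  have := Real.sin_sq_add_cos_sq x
  linear_combination (t ^ 2 - 1) * this

lemma n3 (x : ℝ) : ‖1 - Complex.exp (I * x) ^ 2‖ = 2 * |Real.sin x| := by
  rw [← sq_eq_sq₀ (norm_nonneg _) (by positivity), mul_pow, sq_abs, Complex.sq_norm, Complex.normSq_apply, expI_eq]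
  simp [pow_two]
  have := Real.sin_sq_add_cos_sq x
  linear_combination (Real.sin x ^ 2 + Real.cos x ^ 2 - 1) * this

def sk (t x : ℝ) : ℝ := |Real.sin x| / ((t - Real.cos x) ^ 2 + Real.sin x ^ 2)

lemma sk_nonneg (t x : ℝ) : 0 ≤ sk t x := by unfold sk; positivity

lemma KK_le {t : ℝ} (ht : |t| < 1) (x : ℝ) : ‖KK t x‖ ≤ 4 * sk t x := by
  have hp : 0 < ‖Complex.exp (I * x) - t‖ := norm_pos_iff.2 (expI_sub_ne ht x)
  have h1 : 1 - |t| ≤ ‖Complex.exp (I * x) - t‖ := by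
    have := norm_sub_norm_le (Complex.exp (I * x)) t
    rwa [norm_expI, Complex.norm_real, Real.norm_eq_abs] at this
  have h2 : ‖(1 - t ^ 2 : ℂ)‖ ≤ 2 * ‖Complex.exp (I * x) - t‖ := by
    rw [show (1 - t ^ 2 : ℂ) = ((1 - t ^ 2 : ℝ) : ℂ) by push_cast; rfl, Complex.norm_real,
      Real.norm_of_nonneg (by have := (sq_lt_one_iff_abs_lt_one t).2 ht; linarith)]
    rw [← sq_abs]
    nlinarith [abs_nonneg t]
  rw [KK, sk, norm_div, norm_mul, norm_mul, norm_pow, n2, n3, ← n1]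
  set d := ‖Complex.exp (I * x) - t‖
  calc 2 * |Real.sin x| * ‖(1 - t ^ 2 : ℂ)‖ / (d ^ 2 * d) ≤ 2 * |Real.sin x| * (2 * d) / (d ^ 2 * d) := by
        gcongr
    _ = _ := by field_simp; ring

lemma sk_int (x : ℝ) : Integrable (fun t => sk t x) ∧ ∫ t, sk t x ≤ π := by
  by_cases hs : Real.sin x = 0
  · have : (fun t => sk t x) = fun _ => 0 := by ext t; simp [sk, hs]
    rw [this]
    simp [Real.pi_pos.le]
  · have hs' : 0 < |Real.sin x| := abs_pos.2 hs
    have e : (fun t => sk t x) = fun t => |Real.sin x|⁻¹ * (1 + ((t - Real.cos x) / |Real.sin x|) ^ 2)⁻¹ := by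
      ext t
      rw [sk, ← sq_abs (Real.sin x)]
      field_simp
      ring
    have i1 : Integrable (fun t : ℝ => (1 + (t / |Real.sin x|) ^ 2)⁻¹) :=
      integrable_inv_one_add_sq.comp_div hs'.ne'
    have i2 := i1.comp_sub_right (Real.cos x)
    rw [e]
    refine ⟨i2.const_mul _, ?_⟩
    rw [integral_const_mul, integral_sub_right_eq_self (fun t : ℝ => (1 + (t / |Real.sin x|) ^ 2)⁻¹),
      Measure.integral_comp_div (fun t : ℝ => (1 + t ^ 2)⁻¹), integral_univ_inv_one_add_sq]
    simp only [abs_abs, smul_eq_mul]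
    rw [inv_mul_cancel_left₀ hs'.ne']

lemma KK_meas : Measurable (fun p : ℝ × ℝ => KK p.1 p.2) := by
  unfold KK
  fun_prop

/-- admissible densities -/
structure Adm (H : ℝ → ℂ) (M : ℝ) : Prop where
  meas : Measurable H
  bd : ∀ t, ‖H t‖ ≤ M
  supp : ∀ t, 1 ≤ |t| → H t = 0

lemma Adm.le {H : ℝ → ℂ} {M : ℝ} (h : Adm H M) (t x : ℝ) : ‖H t * KK t x‖ ≤ M * (4 * sk t x) := by
  have hM : 0 ≤ M := (norm_nonneg _).trans (h.bd 0)
  have := sk_nonneg t x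
  by_cases ht : |t| < 1
  · rw [norm_mul]
    exact mul_le_mul (h.bd t) (KK_le ht x) (norm_nonneg _) hM
  · rw [h.supp t (not_lt.1 ht)]
    simp
    positivity

lemma Adm.int {H : ℝ → ℂ} {M : ℝ} (h : Adm H M) (x : ℝ) : Integrable (fun t => H t * KK t x) := by
  refine (((sk_int x).1.const_mul 4).const_mul M).mono' ?_ (Filter.Eventually.of_forall fun t => h.le t x)
  exact (h.meas.mul (KK_meas.comp (measurable_id.prodMk measurable_const))).aestronglyMeasurable

lemma Adm.int_norm {H : ℝ → ℂ} {M : ℝ} (h : Adm H M) (x : ℝ) : ∫ t, ‖H t * KK t x‖ ≤ 4 * π * M := by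
  have hM : 0 ≤ M := (norm_nonneg _).trans (h.bd 0)
  calc _ ≤ ∫ t, M * (4 * sk t x) :=
        integral_mono (h.int x).norm (((sk_int x).1.const_mul 4).const_mul M) (fun t => h.le t x)
    _ = M * (4 * ∫ t, sk t x) := by rw [integral_const_mul, integral_const_mul]
    _ ≤ M * (4 * π) := by gcongr; exact (sk_int x).2
    _ = _ := by ring

def TT (H : ℝ → ℂ) (x : ℝ) : ℂ := ∫ t, H t * KK t x

lemma Adm.TT_le {H : ℝ → ℂ} {M : ℝ} (h : Adm H M) (x : ℝ) : ‖TT H x‖ ≤ 4 * π * M :=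
  (norm_integral_le_integral_norm _).trans (h.int_norm x)

lemma KK_per (t : ℝ) : Function.Periodic (KK t) (2 * π) := by
  intro x
  have : Complex.exp (I * ((x + 2 * π : ℝ) : ℂ)) = Complex.exp (I * x) := by
    rw [expI_eq, expI_eq, Real.cos_add_two_pi, Real.sin_add_two_pi]
  simp only [KK, this]

lemma TT_per (H : ℝ → ℂ) : Function.Periodic (TT H) (2 * π) := by
  intro x
  simp only [TT, (KK_per _) x]

lemma KK_cont {t : ℝ} (ht : |t| < 1) : Continuous (KK t) := by
  unfold KK
  refine Continuous.div (by fun_prop) (by fun_prop) fun x => ?_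
  exact mul_ne_zero (pow_ne_zero _ (one_sub_ne ht (norm_expI x).le)) (expI_sub_ne ht x)

lemma sk_le {r t : ℝ} (hr : r < 1) (ht : |t| ≤ r) (x : ℝ) : sk t x ≤ 1 / (1 - r) ^ 2 := by
  have h1 : 1 - r ≤ ‖Complex.exp (I * x) - t‖ := by
    have := norm_sub_norm_le (Complex.exp (I * x)) t
    rw [norm_expI, Complex.norm_real, Real.norm_eq_abs] at this
    linarith
  rw [sk, ← n1]
  have h0 : 0 < 1 - r := by linarith
  have := Real.abs_sin_le_one x
  gcongr

lemma TT_cont_cut {H : ℝ → ℂ} {M r : ℝ} (h : Adm H M) (hr : r < 1) (h0 : ∀ t, r < |t| → H t = 0) :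
    Continuous (TT H) := by
  have hM : 0 ≤ M := (norm_nonneg _).trans (h.bd 0)
  refine continuous_of_dominated (bound := fun t => (Set.Icc (-1 : ℝ) 1).indicator
    (fun _ => M * (4 * (1 / (1 - r) ^ 2))) t) ?_ ?_ ?_ ?_
  · intro x; exact (h.int x).aestronglyMeasurable
  · intro x
    refine Filter.Eventually.of_forall fun t => ?_
    by_cases ht : |t| ≤ r
    · rw [Set.indicator_of_mem (by rw [Set.mem_Icc, ← abs_le]; linarith)]
      refine (h.le t x).trans ?_
      have := sk_le hr ht x
      gcongr
    · rw [h0 t (not_le.1 ht), zero_mul, norm_zero]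
      exact Set.indicator_nonneg (fun _ _ => by positivity) _
  · rw [integrable_indicator_iff measurableSet_Icc]
    exact continuousOn_const.integrableOn_Icc
  · refine Filter.Eventually.of_forall fun t => ?_
    by_cases ht : |t| < 1
    · exact continuous_const.mul (KK_cont ht)
    · simp only [h.supp t (not_lt.1 ht), zero_mul]
      exact continuous_const

lemma TT_cont {H : ℝ → ℂ} {M : ℝ} (h : Adm H M)
    (h0 : ∀ ε > 0, ∃ r < 1, ∀ t, r < |t| → ‖H t‖ ≤ ε) : Continuous (TT H) := by
  refine continuous_of_uniform_approx_of_continuous fun u hu => ?_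
  obtain ⟨ε, hε, hu⟩ := Metric.mem_uniformity_dist.1 hu
  have hpi := Real.pi_pos
  obtain ⟨r, hr, hH⟩ := h0 (ε / (8 * π)) (by positivity)
  have hM : 0 ≤ M := (norm_nonneg _).trans (h.bd 0)
  set S : Set ℝ := {t | |t| ≤ r}
  have hS : MeasurableSet S := measurableSet_le (by fun_prop) measurable_const
  have hA : Adm (S.indicator H) M := by
    refine ⟨h.meas.indicator hS, fun t => ?_, fun t ht => ?_⟩
    · by_cases htS : t ∈ S
      · rw [Set.indicator_of_mem htS]; exact h.bd t
      · rw [Set.indicator_of_notMem htS, norm_zero]; exact hM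
    · by_cases htS : t ∈ S
      · rw [Set.indicator_of_mem htS]; exact h.supp t ht
      · rw [Set.indicator_of_notMem htS]
  have hB : Adm (Sᶜ.indicator H) (ε / (8 * π)) := by
    refine ⟨h.meas.indicator hS.compl, fun t => ?_, fun t ht => ?_⟩
    · by_cases htS : t ∈ Sᶜ
      · rw [Set.indicator_of_mem htS]; exact hH t (not_le.1 htS)
      · rw [Set.indicator_of_notMem htS, norm_zero]; positivity
    · by_cases htS : t ∈ Sᶜ
      · rw [Set.indicator_of_mem htS]; exact h.supp t ht
      · rw [Set.indicator_of_notMem htS]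
  refine ⟨TT (S.indicator H), TT_cont_cut hA hr fun t ht => ?_, fun x => hu ?_⟩
  · have : t ∉ S := not_le.2 ht
    exact Set.indicator_of_notMem this H
  · have e : TT H x = TT (S.indicator H) x + TT (Sᶜ.indicator H) x := by
      rw [TT, TT, TT, ← integral_add (hA.int x) (hB.int x)]
      refine integral_congr_ae (Filter.Eventually.of_forall fun t => ?_)
      simp only
      rw [← add_mul]
      congr 1
      exact (congrFun (Set.indicator_self_add_compl S H) t).symm
    rw [dist_eq_norm, e, add_sub_cancel_left]
    refine (hB.TT_le x).trans_lt ?_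
    rw [show 4 * π * (ε / (8 * π)) = ε / 2 by field_simp; norm_num]
    linarith

lemma mn_KK {t : ℝ} (ht : |t| < 1) (n : ℕ) : mn (KK t * ex ((n : ℤ) + 1)) = (t : ℂ) ^ n := by
  have hg : DifferentiableOn ℂ (fun z : ℂ => z ^ n * ((1 - z ^ 2) * (1 - t ^ 2 : ℂ) / (1 - z * t) ^ 2)) (Metric.closedBall 0 1) := by
    intro z hz
    have hz' : ‖z‖ ≤ 1 := by simpa using hz
    have := pow_ne_zero 2 (one_sub_ne ht hz')
    exact DifferentiableAt.differentiableWithinAt (by fun_prop (disch := assumption))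
  have h := cauchy hg ht
  have h2 : (1 - t * t : ℂ) ≠ 0 := by
    have := one_sub_ne ht (z := t) (by simpa using ht.le)
    exact this
  rw [show (t : ℂ) ^ n * ((1 - t ^ 2) * (1 - t ^ 2 : ℂ) / (1 - t * t) ^ 2) = (t:ℂ) ^ n by
    rw [sq (t : ℂ), ← sq, div_self (pow_ne_zero 2 h2), mul_one]] at h
  rw [← h]
  congr 1
  ext x
  have h3 : ex ((n : ℤ) + 1) x = Complex.exp (I * x) ^ n * Complex.exp (I * x) := by
    rw [ex, ← Complex.exp_nat_mul, ← Complex.exp_add]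
    push_cast
    ring_nf
  have h4 := expI_sub_ne ht x
  have h5 := one_sub_ne ht (norm_expI x).le
  rw [Pi.mul_apply, h3, KK]
  field_simp

lemma Adm.mn_TT {H : ℝ → ℂ} {M : ℝ} (h : Adm H M) (n : ℕ) :
    mn (TT H * ex ((n : ℤ) + 1)) = ∫ t, H t * (t : ℂ) ^ n := by
  have hcong : ∀ t, H t * (t : ℂ) ^ n = (1 / (2 * π)) * ∫ x in Set.Ioc (0 : ℝ) (2 * π), H t * KK t x * ex ((n : ℤ) + 1) x := by
    intro t
    by_cases ht : |t| < 1
    · rw [← mn_KK ht, mn, intervalIntegral.integral_of_le Real.two_pi_pos.le]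
      rw [mul_left_comm, ← integral_const_mul (H t)]
      simp only [Pi.mul_apply, mul_assoc]
    · simp [h.supp t (not_lt.1 ht)]
  simp only [hcong]
  rw [integral_const_mul, mn, intervalIntegral.integral_of_le Real.two_pi_pos.le]
  congr 1
  rw [integral_integral_swap (f := fun t x => H t * KK t x * ex ((n : ℤ) + 1) x)]
  · refine integral_congr_ae (Filter.Eventually.of_forall fun x => ?_)
    simp only [Pi.mul_apply, TT]
    rw [integral_mul_const]
  · have hme : Measurable (Function.uncurry fun t x => H t * KK t x * ex ((n : ℤ) + 1) x) := by
      refine ((h.meas.comp measurable_fst).mul KK_meas).mul ?_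
      exact (ex_linf ((n : ℤ) + 1)).2.1.comp measurable_snd
    have nex : ∀ x, ‖ex ((n : ℤ) + 1) x‖ = 1 := by
      intro x
      rw [ex, show I * (((n : ℤ) + 1 : ℤ) : ℂ) * x = I * ((((n : ℤ) + 1 : ℤ) : ℝ) * x : ℝ) by push_cast; ring]
      exact norm_expI _
    rw [integrable_prod_iff' hme.aestronglyMeasurable]
    constructor
    · refine Filter.Eventually.of_forall fun x => ?_
      exact (h.int x).mul_const (ex ((n : ℤ) + 1) x)
    · refine Integrable.mono' (g := fun _ => 4 * π * M) (integrable_const _) ?_ ?_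
      · exact (hme.norm.comp measurable_swap).stronglyMeasurable.integral_prod_right'.aestronglyMeasurable
      · refine Filter.Eventually.of_forall fun x => ?_
        simp only [norm_mul (_ * _) (ex _ _), nex, mul_one, Function.uncurry]
        rw [Real.norm_of_nonneg (integral_nonneg fun t => norm_nonneg _)]
        exact h.int_norm x

end QCP

namespace QCP
open Complex (I)

lemma chi_linf : chiPlus ∈ LinfT := by
  refine ⟨fun x => by simp [chiPlus], ?_, 1, fun x => ?_⟩
  · unfold chiPlus
    refine Measurable.ite (measurableSet_lt measurable_const Real.measurable_sin) measurable_const measurable_const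
  · unfold chiPlus; split_ifs <;> simp

lemma mn_chi {g : ℝ → ℂ} (hg : g ∈ LinfT) : mn (chiPlus * g) = (1 / (2 * π)) * ∫ x in (0 : ℝ)..π, g x := by
  have hpi := Real.pi_pos
  have hl := linf_mul chi_linf hg
  rw [mn, ← intervalIntegral.integral_add_adjacent_intervals (linf_int hl 0 π) (linf_int hl π (2 * π))]
  have h1 : ∫ x in (0 : ℝ)..π, (chiPlus * g) x = ∫ x in (0 : ℝ)..π, g x := by
    rw [intervalIntegral.integral_of_le hpi.le, intervalIntegral.integral_of_le hpi.le,
      integral_Ioc_eq_integral_Ioo, integral_Ioc_eq_integral_Ioo]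
    refine setIntegral_congr_fun measurableSet_Ioo fun x hx => ?_
    simp [chiPlus, Real.sin_pos_of_pos_of_lt_pi hx.1 hx.2]
  have h2 : ∫ x in π..(2 * π), (chiPlus * g) x = 0 := by
    rw [intervalIntegral.integral_of_le (by linarith)]
    refine setIntegral_eq_zero_of_forall_eq_zero fun x hx => ?_
    have : Real.sin x ≤ 0 := by
      have := Real.sin_nonneg_of_nonneg_of_le_pi (x := x - π) (by linarith [hx.1]) (by linarith [hx.2])
      rw [Real.sin_sub_pi] at this
      linarith
    simp [chiPlus, not_lt.2 this]
  rw [h1, h2, add_zero]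

lemma chi_ex (k : ℕ) : mn (chiPlus * ex ((k : ℤ) + 1)) = (I / (2 * π)) * ∫ t in (-1 : ℝ)..1, (t : ℂ) ^ k := by
  have hI := Complex.I_ne_zero
  have hk : ((k : ℂ) + 1) ≠ 0 := by exact_mod_cast Nat.succ_ne_zero k
  rw [mn_chi (ex_linf _)]
  have h1 : ∫ x in (0 : ℝ)..π, ex ((k : ℤ) + 1) x = ((-1) ^ (k + 1) - 1) / (I * (k + 1)) := by
    have := integral_exp_mul_complex (a := 0) (b := π) (c := I * (k + 1)) (mul_ne_zero hI hk)
    simp only [ex]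
    push_cast
    rw [this]
    congr 2
    · rw [show I * ((k : ℂ) + 1) * π = ((k + 1 : ℕ) : ℂ) * (π * I) by push_cast; ring, Complex.exp_nat_mul,
        Complex.exp_pi_mul_I]
    · simp
  have h2 : ∫ t in (-1 : ℝ)..1, (t : ℂ) ^ k = (1 - (-1) ^ (k + 1)) / (k + 1) := by
    have : ∀ t : ℝ, (t : ℂ) ^ k = ((t ^ k : ℝ) : ℂ) := fun t => by push_cast; rfl
    simp only [this]
    rw [intervalIntegral.integral_ofReal, integral_pow]
    push_cast
    simp
  rw [h1, h2]
  have hpi : (π : ℂ) ≠ 0 := by exact_mod_cast Real.pi_ne_zero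
  field_simp
  rw [Complex.I_sq]
  ring

lemma abs_pow_int (k : ℕ) : ∫ t in Set.Ioo (-1 : ℝ) 1, |t| ^ k = 2 / (k + 1) := by
  have hi : ∀ a b : ℝ, IntervalIntegrable (fun t : ℝ => |t| ^ k) volume a b :=
    fun a b => Continuous.intervalIntegrable (by fun_prop) a b
  rw [← integral_Ioc_eq_integral_Ioo, ← intervalIntegral.integral_of_le (by norm_num),
    ← intervalIntegral.integral_add_adjacent_intervals (hi (-1) 0) (hi 0 1)]
  have h1 : ∫ t in (0 : ℝ)..1, |t| ^ k = 1 / (k + 1) := by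
    have : ∫ t in (0 : ℝ)..1, |t| ^ k = ∫ t in (0 : ℝ)..1, t ^ k := by
      refine intervalIntegral.integral_congr fun t ht => ?_
      rw [Set.uIcc_of_le zero_le_one] at ht
      simp only [abs_of_nonneg ht.1]
    rw [this, integral_pow]; simp
  have h2 : ∫ t in (-1 : ℝ)..0, |t| ^ k = ∫ t in (0 : ℝ)..1, |t| ^ k := by
    have := intervalIntegral.integral_comp_neg (a := 0) (b := 1) (fun t : ℝ => |t| ^ k)
    simp only [abs_neg, neg_zero] at this
    exact this.symm
  rw [h2, h1]
  ring

lemma sum_sq {h : ℝ → ℂ} (hh : h ∈ LinfT) : Summable (fun m : ℤ => ‖fourierCoef h m‖ ^ 2) := by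
  have := (parseval hh (linf_cj hh)).summable
  rw [← Complex.summable_ofReal]
  refine this.congr fun m => ?_
  rw [fc_cj, neg_neg, Complex.mul_conj, Complex.normSq_eq_norm_sq]

lemma sum_inv : Summable (fun m : ℤ => (1 / ((m.natAbs : ℝ) + 1)) ^ 2) := by
  have h : Summable (fun n : ℕ => (1 / ((n : ℝ) + 1)) ^ 2) := by
    have := (summable_nat_add_iff 1).2 (Real.summable_one_div_nat_pow.2 (le_refl 2))
    refine this.congr fun n => ?_
    push_cast
    rw [div_pow, one_pow]
  refine Summable.of_nat_of_neg ?_ ?_ <;> simpa using h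

lemma half_disc {h : ℝ → ℂ} (hh : h ∈ HinfT) (n : ℕ) :
    mn (h * chiPlus * ex ((n : ℤ) + 1)) =
      (I / (2 * π)) * ∫ t in Set.Ioo (-1 : ℝ) 1, PP h t * (t : ℂ) ^ n := by
  have hcl := linf_mul chi_linf (ex_linf ((n : ℤ) + 1))
  have h1 := parseval hh.1 hcl
  rw [← mul_assoc] at h1
  set F : ℤ → ℝ → ℂ := fun m t => fourierCoef h m * (t : ℂ) ^ (m.natAbs + n) with hF
  have hFi : ∀ m, Integrable (F m) (volume.restrict (Set.Ioo (-1 : ℝ) 1)) := by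
    intro m
    have : Continuous (F m) := by rw [hF]; fun_prop
    exact (this.continuousOn.integrableOn_Icc).mono_set Set.Ioo_subset_Icc_self
  have hFn : ∀ m, ∫ t in Set.Ioo (-1 : ℝ) 1, ‖F m t‖ = ‖fourierCoef h m‖ * (2 / ((m.natAbs + n : ℕ) + 1)) := by
    intro m
    rw [← abs_pow_int, ← integral_const_mul]
    simp [hF]
  have hsum : Summable fun m => ∫ t in Set.Ioo (-1 : ℝ) 1, ‖F m t‖ := by
    refine Summable.of_nonneg_of_le (fun m => integral_nonneg fun t => norm_nonneg _) (fun m => ?_)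
      ((sum_sq hh.1).add sum_inv)
    rw [hFn]
    have hle : (1 : ℝ) / ((m.natAbs + n : ℕ) + 1) ≤ 1 / ((m.natAbs : ℝ) + 1) := by
      apply one_div_le_one_div_of_le (by positivity)
      push_cast
      have : (0 : ℝ) ≤ n := by positivity
      linarith
    have e : (2 : ℝ) / ((m.natAbs + n : ℕ) + 1) = 2 * (1 / ((m.natAbs + n : ℕ) + 1)) := by ring
    rw [e]
    have h0 := norm_nonneg (fourierCoef h m)
    set a := ‖fourierCoef h m‖
    set b := 1 / ((m.natAbs : ℝ) + 1)
    nlinarith [sq_nonneg (a - b), mul_le_mul_of_nonneg_left hle h0]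
  have h2 := (hasSum_integral_of_summable_integral_norm hFi hsum).mul_left (I / (2 * π))
  have e2 : ∫ t in Set.Ioo (-1 : ℝ) 1, ∑' m, F m t = ∫ t in Set.Ioo (-1 : ℝ) 1, PP h t * (t : ℂ) ^ n := by
    refine setIntegral_congr_fun measurableSet_Ioo fun t ht => ?_
    have := (PP_hasSum hh.1 (abs_lt.2 ht)).mul_right ((t : ℂ) ^ n)
    change ∑' m, F m t = _
    rw [← this.tsum_eq]
    refine tsum_congr fun m => ?_
    rw [hF]
    simp only
    ring
  rw [e2] at h2
  refine h1.unique (hs_congr h2 fun m => ?_)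
  rcases lt_or_ge m 0 with hm | hm
  · simp [hF, hh.2 m hm]
  · obtain ⟨k, rfl⟩ := Int.eq_ofNat_of_zero_le hm
    rw [fc_mul_ex, fc_eq chiPlus]
    have e3 := chi_ex (k + n)
    rw [show -(-(k : ℤ) - ((n : ℤ) + 1)) = ((k + n : ℕ) : ℤ) + 1 by push_cast; ring, e3]
    simp only [hF, Int.natAbs_natCast]
    rw [integral_const_mul, intervalIntegral.integral_of_le (by norm_num), integral_Ioc_eq_integral_Ioo]
    ring

end QCP

namespace QCP
open Complex (I)

lemma mn_ex_ne {k : ℤ} (hk : k ≠ 0) : mn (ex k) = 0 := by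
  have hk' : I * (k : ℂ) ≠ 0 := mul_ne_zero Complex.I_ne_zero (by exact_mod_cast hk)
  have := integral_exp_mul_complex (a := 0) (b := 2 * π) hk'
  simp only [mn, ex]
  rw [this, show I * (k : ℂ) * ((2 * π : ℝ) : ℂ) = k * (2 * π * I) by push_cast; ring,
    Complex.exp_int_mul_two_pi_mul_I]
  simp

lemma ex_hinf {n : ℤ} (hn : 0 ≤ n) : ex n ∈ HinfT := by
  refine ⟨ex_linf n, fun m hm => ?_⟩
  rw [fc_eq, ex_mul]
  exact mn_ex_ne (by omega)

lemma hinf_add {f g : ℝ → ℂ} (hf : f ∈ HinfT) (hg : g ∈ HinfT) : f + g ∈ HinfT :=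
  ⟨linf_add hf.1 hg.1, fun n hn => by rw [fc_add hf.1 hg.1, hf.2 n hn, hg.2 n hn, add_zero]⟩

lemma hinf_smul (c : ℂ) {f : ℝ → ℂ} (hf : f ∈ HinfT) : c • f ∈ HinfT :=
  ⟨linf_smul c hf.1, fun n hn => by rw [fc_smul, hf.2 n hn, mul_zero]⟩

lemma ch_norm {q : ℝ → ℂ} (hq : q ∈ CH) :
    ∃ c ∈ CtsT, ∃ h ∈ HinfT, q = c + h ∧ c 0 = 0 ∧ c π = 0 := by
  obtain ⟨c, hc, h, hh, rfl⟩ := hq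
  set e : ℝ → ℂ := ((c 0 + c π) / 2) • ex 0 + ((c 0 - c π) / 2) • ex 1 with he
  have heh : e ∈ HinfT := hinf_add (hinf_smul _ (ex_hinf le_rfl)) (hinf_smul _ (ex_hinf zero_le_one))
  have hec : Continuous e := by
    have h0 := (ex_cts 0).2
    have h1 := (ex_cts 1).2
    rw [he]
    exact (h0.const_smul _).add (h1.const_smul _)
  refine ⟨c - e, ⟨(linf_sub (linf_of_cts hc) heh.1).1, hc.2.sub hec⟩, h + e, hinf_add hh heh, ?_, ?_, ?_⟩
  · ring
  · simp [he, ex]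
    ring
  · have : Complex.exp (I * π) = -1 := by rw [mul_comm, Complex.exp_pi_mul_I]
    simp [he, ex, this]
    ring

lemma cts_chi {c : ℝ → ℂ} (hc : c ∈ CtsT) (h0 : c 0 = 0) (h1 : c π = 0) : c * chiPlus ∈ CtsT := by
  refine ⟨(linf_mul (linf_of_cts hc) chi_linf).1, ?_⟩
  have e : c * chiPlus = fun x => if Real.sin x ≤ 0 then 0 else c x := by
    ext x
    by_cases hx : Real.sin x ≤ 0
    · simp [chiPlus, hx, not_lt.2 hx]
    · simp [chiPlus, hx, not_le.1 hx]
  rw [e]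
  refine Continuous.if_le continuous_const hc.2 Real.continuous_sin continuous_const fun x hx => ?_
  obtain ⟨k, rfl⟩ := Real.sin_eq_zero_iff.1 hx
  obtain ⟨m, rfl | rfl⟩ := k.even_or_odd'
  · have := hc.1.int_mul m 0
    rw [h0] at this
    rw [← this]
    congr 1
    push_cast
    ring
  · have := hc.1.int_mul m π
    rw [h1] at this
    rw [← this]
    congr 1
    push_cast
    ring

lemma PP_meas {h : ℝ → ℂ} (hh : h ∈ LinfT) : Measurable (PP h) := by
  have hm : Measurable (fun p : ℝ × ℝ => h p.2 * pkC p.1 p.2) := by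
    refine (hh.2.1.comp measurable_snd).mul ?_
    unfold pkC pk
    fun_prop
  have := hm.stronglyMeasurable.integral_prod_right' (ν := volume.restrict (Set.Ioc (0 : ℝ) (2 * π)))
  have e : PP h = fun t => (1 / (2 * π) : ℂ) * ∫ x in Set.Ioc (0 : ℝ) (2 * π), h x * pkC t x := by
    ext t
    rw [PP, mn, intervalIntegral.integral_of_le Real.two_pi_pos.le]
    rfl
  rw [e]
  exact this.measurable.const_mul _

lemma ch_chi {q : ℝ → ℂ} (hq : q ∈ CH) (hp : Tendsto (PP q) (𝓝[<] 1) (𝓝 0))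
    (hm : Tendsto (fun t => PP q (-t)) (𝓝[<] 1) (𝓝 0)) : q * chiPlus ∈ CH := by
  obtain ⟨c, hc, h, hh, rfl, h0, h1⟩ := ch_norm hq
  have hcl := linf_of_cts hc
  have tp : Tendsto (PP h) (𝓝[<] 1) (𝓝 0) := by
    have := hp.sub (PP_cts hc)
    rw [h0, sub_zero] at this
    refine this.congr' ?_
    filter_upwards [ev_lt_one] with t ht
    rw [PP_add hcl hh.1 ht, add_sub_cancel_left]
  have tm : Tendsto (fun t => PP h (-t)) (𝓝[<] 1) (𝓝 0) := by
    have h2 := PP_cts (cts_sh π hc)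
    rw [show sh π c 0 = 0 by simp [sh, h1]] at h2
    have := hm.sub h2
    rw [sub_zero] at this
    refine this.congr' ?_
    filter_upwards [ev_lt_one] with t ht
    have ht' : |-t| < 1 := by rwa [abs_neg]
    rw [PP_add hcl hh.1 ht', PP_sh_pi hcl ht, add_sub_cancel_left]
  obtain ⟨M, hM⟩ := hh.1.2.2
  have hM0 : 0 ≤ M := (norm_nonneg _).trans (hM 0)
  set H : ℝ → ℂ := (Set.Ioo (-1 : ℝ) 1).indicator (PP h) with hH
  have hA : Adm H M := by
    refine ⟨(PP_meas hh.1).indicator measurableSet_Ioo, fun t => ?_, fun t ht => ?_⟩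
    · by_cases hts : t ∈ Set.Ioo (-1 : ℝ) 1
      · rw [hH, Set.indicator_of_mem hts]; exact PP_norm_le (abs_lt.2 hts) hM
      · rw [hH, Set.indicator_of_notMem hts, norm_zero]; exact hM0
    · refine Set.indicator_of_notMem (fun hts => ?_) _
      exact absurd (abs_lt.2 hts) (not_lt.2 ht)
  have hcont : Continuous (TT H) := by
    refine TT_cont hA fun ε hε => ?_
    have a1 : {t | ‖PP h t‖ < ε} ∈ 𝓝[<] (1 : ℝ) := by
      have := Metric.tendsto_nhds.1 tp ε hε
      simp only [dist_zero_right] at this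
      exact this
    have a2 : {t | ‖PP h (-t)‖ < ε} ∈ 𝓝[<] (1 : ℝ) := by
      have := Metric.tendsto_nhds.1 tm ε hε
      simp only [dist_zero_right] at this
      exact this
    obtain ⟨l, hl, hs⟩ := mem_nhdsLT_iff_exists_Ioo_subset.1 (Filter.inter_mem a1 a2)
    refine ⟨l, hl, fun t ht => ?_⟩
    by_cases hts : t ∈ Set.Ioo (-1 : ℝ) 1
    · rw [hH, Set.indicator_of_mem hts]
      have hlt := abs_lt.2 hts
      rcases le_total 0 t with h3 | h3
      · rw [abs_of_nonneg h3] at ht hlt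
        exact (hs ⟨ht, hlt⟩).1.le
      · rw [abs_of_nonpos h3] at ht hlt
        have := (hs ⟨ht, hlt⟩).2
        simp only [Set.mem_setOf_eq, neg_neg] at this
        exact this.le
    · rw [hH, Set.indicator_of_notMem hts, norm_zero]; exact hε.le
  have hT : TT H ∈ CtsT := ⟨TT_per H, hcont⟩
  have hF : (I / (2 * π)) • TT H ∈ CtsT :=
    ⟨(linf_smul _ (linf_of_cts hT)).1, hcont.const_smul _⟩
  have hcc := cts_chi hc h0 h1
  have hhl := linf_mul hh.1 chi_linf
  refine ⟨c * chiPlus + (I / (2 * π)) • TT H, ⟨(linf_add (linf_of_cts hcc) (linf_of_cts hF)).1, hcc.2.add hF.2⟩,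
    h * chiPlus - (I / (2 * π)) • TT H, ⟨linf_sub hhl (linf_of_cts hF), fun n hn => ?_⟩, by ring⟩
  obtain ⟨m, hm⟩ := Int.eq_ofNat_of_zero_le (show 0 ≤ -n - 1 by omega)
  rw [fc_sub hhl (linf_of_cts hF), fc_smul, fc_eq, fc_eq, show -n = (m : ℤ) + 1 by omega,
    half_disc hh, hA.mn_TT, ← integral_indicator measurableSet_Ioo, sub_eq_zero]
  congr 2
  ext t
  by_cases hts : t ∈ Set.Ioo (-1 : ℝ) 1
  · rw [hH, Set.indicator_of_mem hts, Set.indicator_of_mem hts]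
  · rw [hH, Set.indicator_of_notMem hts, Set.indicator_of_notMem hts, zero_mul]

lemma cj_tendsto {q : ℝ → ℂ} {u : ℝ → ℝ} (h : Tendsto (fun t => PP q (u t)) (𝓝[<] 1) (𝓝 0)) :
    Tendsto (fun t => PP (cj q) (u t)) (𝓝[<] 1) (𝓝 0) := by
  have := (Complex.continuous_conj.tendsto 0).comp h
  rw [map_zero] at this
  refine this.congr fun t => ?_
  rw [PP_cj]; rfl

lemma qc_chi {q : ℝ → ℂ} (hq : q ∈ QCset) (hp : Tendsto (PP q) (𝓝[<] 1) (𝓝 0))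
    (hm : Tendsto (fun t => PP q (-t)) (𝓝[<] 1) (𝓝 0)) : q * chiPlus ∈ QCset := by
  obtain ⟨h1, h2⟩ := (qc_iff q).1 hq
  refine (qc_iff _).2 ⟨ch_chi h1 hp hm, ?_⟩
  have e : cj (q * chiPlus) = cj q * chiPlus := by
    rw [cj_mul]
    congr 1
    ext x
    simp only [cj, chiPlus]
    split_ifs <;> simp
  rw [e]
  exact ch_chi h2 (cj_tendsto (u := fun t => t) hp) (cj_tendsto (u := fun t => -t) hm)

lemma ch_sub {f g : ℝ → ℂ} (hf : f ∈ CH) (hg : g ∈ CH) : f - g ∈ CH := by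
  obtain ⟨c, hc, h, hh, rfl⟩ := hf
  obtain ⟨d, hd, k, hk, rfl⟩ := hg
  refine ⟨c - d, ⟨(linf_sub (linf_of_cts hc) (linf_of_cts hd)).1, hc.2.sub hd.2⟩, h - k,
    ⟨linf_sub hh.1 hk.1, fun n hn => ?_⟩, by ring⟩
  rw [fc_sub hh.1 hk.1, hh.2 n hn, hk.2 n hn, sub_zero]

lemma cj_sub (f g : ℝ → ℂ) : cj (f - g) = cj f - cj g := by ext x; simp [cj]

lemma qc_sub {f g : ℝ → ℂ} (hf : f ∈ QCset) (hg : g ∈ QCset) : f - g ∈ QCset := by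
  rw [qc_iff] at *
  refine ⟨ch_sub hf.1 hg.1, ?_⟩
  rw [cj_sub]
  exact ch_sub hf.2 hg.2

lemma ae_sin : ∀ᵐ x : ℝ, Real.sin x ≠ 0 := by
  have : {x : ℝ | Real.sin x = 0} = Set.range (fun k : ℤ => (k : ℝ) * π) := by
    ext x
    simp only [Set.mem_setOf_eq, Set.mem_range]
    exact Real.sin_eq_zero_iff
  have h := (Set.countable_range (fun k : ℤ => (k : ℝ) * π)).measure_zero volume
  rw [← this] at h
  rw [ae_iff]
  simpa using h

lemma qc_null {f : ℝ → ℂ} (hf : f ∈ LinfT) (h0 : ∀ x, Real.sin x ≠ 0 → f x = 0) : f ∈ QCset := by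
  have hz : ∀ n, fourierCoef f n = 0 := by
    intro n
    rw [fourierCoef, intervalIntegral.integral_zero_ae, mul_zero]
    filter_upwards [ae_sin] with x hx _
    rw [h0 x hx, zero_mul]
  have hc : (0 : ℝ → ℂ) ∈ CtsT := ⟨fun x => rfl, continuous_const⟩
  exact ⟨⟨0, hc, f, ⟨hf, fun n _ => hz n⟩, (zero_add f).symm⟩, ⟨0, hc, f, ⟨hf, fun n _ => hz n⟩, (zero_add f).symm⟩⟩

lemma chim_linf : chiMinus ∈ LinfT := by
  refine ⟨fun x => by simp [chiMinus], ?_, 1, fun x => ?_⟩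
  · unfold chiMinus
    refine Measurable.ite (measurableSet_lt Real.measurable_sin measurable_const) measurable_const measurable_const
  · unfold chiMinus; split_ifs <;> simp

lemma qc_chim {q : ℝ → ℂ} (hq : q ∈ QCset) (h : q * chiPlus ∈ QCset) : q * chiMinus ∈ QCset := by
  have hl := qc_linf hq
  have hn : q - q * chiPlus - q * chiMinus ∈ QCset := by
    refine qc_null (linf_sub (linf_sub hl (linf_mul hl chi_linf)) (linf_mul hl chim_linf)) fun x hx => ?_
    simp only [Pi.sub_apply, Pi.mul_apply, chiPlus, chiMinus]
    rcases lt_or_gt_of_ne hx with h | h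
    · simp [h, h.le, not_lt.2 h.le]
    · simp [h, not_lt.2 h.le]
  have := qc_sub (qc_sub hq h) hn
  rwa [sub_sub_cancel] at this

end QCP

/-- If `q ∈ QC` and the Gelfand transform of `q` vanishes on `M_1^0(QC)` (angle `0`) and on
`M_{-1}^0(QC)` (angle `π`), then `qχ_+ ∈ QC` and `qχ_- ∈ QC`. -/
theorem mul_chi_in_QC (q : ℝ → ℂ) (hq : q ∈ QCset)
    (h1 : ∀ ξ, InM0 QCset 0 ξ → ξ q = 0)
    (h2 : ∀ ξ, InM0 QCset π ξ → ξ q = 0) :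
    q * chiPlus ∈ QCset ∧ q * chiMinus ∈ QCset := by
  obtain ⟨hp, hm⟩ := QCP.PP_zero hq h1 h2
  have h := QCP.qc_chi hq hp hm
  exact ⟨h, QCP.qc_chim hq h⟩
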